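/- Fix an arbitrary ordering of 4 agents whose valuations are non-degenerate and cancelable. Let X be a partial EFX allocation in which at least two items are unallocated. Then there exists a partial EFX allocation Y that dominates X. -/

import Mathlib

namespace FairDivision

open Finset

/-- A valuation: nonnegative, zero on the empty set, monotone. -/
def IsValuation {ι : Type*} (v : Finset ι → ℝ) : Prop :=
  v ∅ = 0 ∧ (∀ S : Finset ι, 0 ≤ v S) ∧ ∀ ⦃S T : Finset ι⦄, S ⊆ T → v S ≤ v T

/-- `v` is cancelable: `v (S ∪ {g}) > v (T ∪ {g})` implies `v S > v T`. -/
def Cancelable {ι : Type*} [DecidableEq ι] (v : Finset ι → ℝ) : Prop :=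
  ∀ S T : Finset ι, ∀ g : ι, g ∉ S → g ∉ T →
    v (insert g S) > v (insert g T) → v S > v T

/-- `v` is non-degenerate: distinct bundles have distinct values. -/
def NonDegenerate {ι : Type*} (v : Finset ι → ℝ) : Prop :=
  ∀ S T : Finset ι, S ≠ T → v S ≠ v T

/-- `v'` respects `v`: every strict inequality of `v` is a strict inequality of `v'`. -/
def Respects {ι : Type*} (v' v : Finset ι → ℝ) : Prop :=
  ∀ S T : Finset ι, v S > v T → v' S > v' T

/-- `v` is a nice cancelable valuation: cancelable, and some non-degenerate
cancelable valuation respects it. -/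
def NiceCancelable {ι : Type*} [DecidableEq ι] (v : Finset ι → ℝ) : Prop :=
  Cancelable v ∧ ∃ v' : Finset ι → ℝ,
    IsValuation v' ∧ NonDegenerate v' ∧ Cancelable v' ∧ Respects v' v

/-- A partial allocation: the bundles are pairwise disjoint. -/
def IsPartialAlloc {ι : Type*} {n : ℕ} (X : Fin n → Finset ι) : Prop :=
  ∀ i j : Fin n, i ≠ j → Disjoint (X i) (X j)

/-- The set of unallocated items. -/
def unalloc {ι : Type*} [DecidableEq ι] [Fintype ι] {n : ℕ}
    (X : Fin n → Finset ι) : Finset ι :=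
  Finset.univ \ Finset.univ.biUnion X

/-- Agent `i` envies the set `S`. -/
def EnviesSet {ι : Type*} {n : ℕ} (v : Fin n → Finset ι → ℝ) (X : Fin n → Finset ι)
    (i : Fin n) (S : Finset ι) : Prop :=
  v i (X i) < v i S

/-- Agent `i` strongly envies the set `S`. -/
def StrongEnviesSet {ι : Type*} [DecidableEq ι] {n : ℕ} (v : Fin n → Finset ι → ℝ)
    (X : Fin n → Finset ι) (i : Fin n) (S : Finset ι) : Prop :=
  ∃ h ∈ S, v i (X i) < v i (S.erase h)

/-- The allocation is EFX: no agent strongly envies another agent's bundle. -/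
def IsEFX {ι : Type*} [DecidableEq ι] {n : ℕ} (v : Fin n → Finset ι → ℝ)
    (X : Fin n → Finset ι) : Prop :=
  ∀ i j : Fin n, i ≠ j → ¬ StrongEnviesSet v X i (X j)

/-- `Y` Pareto dominates `X`. -/
def ParetoDominates {ι : Type*} {n : ℕ} (v : Fin n → Finset ι → ℝ)
    (Y X : Fin n → Finset ι) : Prop :=
  (∀ i, v i (X i) ≤ v i (Y i)) ∧ ∃ i, v i (X i) < v i (Y i)

/-- `Y` dominates `X` lexicographically with respect to the ordering `a` of the agents. -/
def Dominates {ι : Type*} {n : ℕ} (v : Fin n → Finset ι → ℝ) (a : Fin n → Fin n)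
    (Y X : Fin n → Finset ι) : Prop :=
  ∃ k : Fin n, (∀ j : Fin n, j < k → v (a j) (Y (a j)) = v (a j) (X (a j))) ∧
    v (a k) (X (a k)) < v (a k) (Y (a k))

/-- Agent `i` is a most envious agent of the set `S`: there is `T ⊆ S` that `i`
envies and that no agent strongly envies.  (`S \ T` is a corresponding discard set.) -/
def MostEnvious {ι : Type*} [DecidableEq ι] {n : ℕ} (v : Fin n → Finset ι → ℝ)
    (X : Fin n → Finset ι) (i : Fin n) (S : Finset ι) : Prop :=
  ∃ T ⊆ S, EnviesSet v X i T ∧ ∀ j : Fin n, ¬ StrongEnviesSet v X j T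

/-- `i` champions `j` with respect to the item `g`:  `i` is a most envious agent
of `X j ∪ {g}`. -/
def ChampG {ι : Type*} [DecidableEq ι] {n : ℕ} (v : Fin n → Finset ι → ℝ)
    (X : Fin n → Finset ι) (g : ι) (i j : Fin n) : Prop :=
  MostEnvious v X i (insert g (X j))

/-- `i` champions `j` with respect to `(H | S)`:  `H ⊆ M \ X j`, `S ⊆ X j`, and `i`
is a most envious agent of `(X j \ S) ∪ H`. -/
def GenChamp {ι : Type*} [DecidableEq ι] {n : ℕ} (v : Fin n → Finset ι → ℝ)
    (X : Fin n → Finset ι) (i j : Fin n) (H S : Finset ι) : Prop :=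
  Disjoint H (X j) ∧ S ⊆ X j ∧ MostEnvious v X i ((X j \ S) ∪ H)

/-- No agent values a proper subset of `S` (hence `S` minus an item) above her level `θ`. -/
def Safe {ι : Type*} [DecidableEq ι] (v : Fin 4 → Finset ι → ℝ) (θ : Fin 4 → ℝ)
    (S : Finset ι) : Prop :=
  ∀ j, ∀ h ∈ S, v j (S.erase h) ≤ θ j

/-- Some EFX allocation dominates `X`. -/
def Improvable {ι : Type*} [DecidableEq ι] (v : Fin 4 → Finset ι → ℝ) (a : Fin 4 → Fin 4)
    (X : Fin 4 → Finset ι) : Prop :=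
  ∃ Y : Fin 4 → Finset ι, IsPartialAlloc Y ∧ IsEFX v Y ∧ Dominates v a Y X

theorem NonDegenerate.lt_of_ssubset {ι : Type*} {w : Finset ι → ℝ} (hnd : NonDegenerate w)
    (hv : IsValuation w) {S T : Finset ι} (h : S ⊂ T) : w S < w T :=
  lt_of_le_of_ne (hv.2.2 h.1) (hnd _ _ h.ne)

/-- Only the agents up to the first one that strictly improves matter. -/
theorem dominates_of_le {ι : Type*} {v : Fin 4 → Finset ι → ℝ} {a : Fin 4 → Fin 4}
    {X Y : Fin 4 → Finset ι} (k : Fin 4)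
    (hle : ∀ j < k, v (a j) (X (a j)) ≤ v (a j) (Y (a j)))
    (hk : v (a k) (X (a k)) < v (a k) (Y (a k))) : Dominates v a Y X := by
  have hne : ({j | v (a j) (X (a j)) < v (a j) (Y (a j))} : Set (Fin 4)).Nonempty := ⟨k, hk⟩
  obtain ⟨m, hm, hmin⟩ := WellFounded.has_min (wellFounded_lt (α := Fin 4)) _ hne
  have hmk : m ≤ k := not_lt.1 (hmin k hk)
  exact ⟨m, fun j hj => le_antisymm (not_lt.1 fun h => hmin j h hj) (hle j (hj.trans_le hmk)), hm⟩

section Valuation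

variable {ι : Type*} [DecidableEq ι] {w : Finset ι → ℝ}

theorem Cancelable.lt_of_union_lt (hc : Cancelable w) {S T R : Finset ι}
    (hS : Disjoint S R) (hT : Disjoint T R) (h : w (S ∪ R) < w (T ∪ R)) : w S < w T := by
  induction R using Finset.induction_on with
  | empty => simpa using h
  | insert g R hg ih =>
    rw [Finset.disjoint_insert_right] at hS hT
    refine ih hS.2 hT.2 (hc _ _ g ?_ ?_ ?_)
    · simp [hT.1, hg]
    · simp [hS.1, hg]
    · simpa [Finset.union_insert] using h

theorem Cancelable.union_le (hc : Cancelable w) {S T R : Finset ι}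
    (hS : Disjoint S R) (hT : Disjoint T R) (h : w S ≤ w T) : w (S ∪ R) ≤ w (T ∪ R) := by
  by_contra hlt
  exact absurd (hc.lt_of_union_lt hT hS (not_le.1 hlt)) (not_lt.2 h)

theorem Cancelable.union_lt (hc : Cancelable w) (hnd : NonDegenerate w) {S T R : Finset ι}
    (hS : Disjoint S R) (hT : Disjoint T R) (h : w S < w T) : w (S ∪ R) < w (T ∪ R) := by
  refine lt_of_le_of_ne (hc.union_le hS hT h.le) (hnd _ _ fun he => ?_)
  have : S = T := by
    rw [← Finset.union_sdiff_cancel_right hS, he, Finset.union_sdiff_cancel_right hT]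
  exact absurd (this ▸ h) (lt_irrefl _)

end Valuation

section Levels

variable {ι : Type*} [DecidableEq ι] {v : Fin 4 → Finset ι → ℝ} {a : Fin 4 → Fin 4}
  {X : Fin 4 → Finset ι}

/-- A minimal envied subset of an envied set is safe. -/
theorem exists_safe_envied (θ : Fin 4 → ℝ) (S : Finset ι) (i : Fin 4) (h : θ i < v i S) :
    ∃ Z ⊆ S, Safe v θ Z ∧ ∃ c, θ c < v c Z := by
  induction S using Finset.strongInduction generalizing i with
  | _ S ih =>
    by_cases hs : Safe v θ S
    · exact ⟨S, subset_rfl, hs, i, h⟩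
    · simp only [Safe, not_forall, not_le] at hs
      obtain ⟨j, e, he, hj⟩ := hs
      obtain ⟨Z, hZ, hZ'⟩ := ih _ (Finset.erase_ssubset he) j hj
      exact ⟨Z, hZ.trans (Finset.erase_subset _ _), hZ'⟩

theorem Safe.mono {θ θ' : Fin 4 → ℝ} {S : Finset ι} (h : Safe v θ S) (hθ : ∀ i, θ i ≤ θ' i) :
    Safe v θ' S := fun j e he => (h j e he).trans (hθ j)

theorem isEFX_of_safe {θ : Fin 4 → ℝ} {Y : Fin 4 → Finset ι} (hs : ∀ i, Safe v θ (Y i))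
    (hθ : ∀ i, θ i ≤ v i (Y i)) : IsEFX v Y := by
  rintro i j - ⟨e, he, h⟩
  exact absurd ((hs j i e he).trans (hθ i)) (not_le.2 h)

theorem safe_own (hval : ∀ i, IsValuation (v i)) (hEFX : IsEFX v X) (j : Fin 4) :
    Safe v (fun i => v i (X i)) (X j) := by
  intro i e he
  by_cases hij : i = j
  · subst hij
    exact (hval i).2.2 (Finset.erase_subset _ _)
  · by_contra hlt
    exact hEFX i j hij ⟨e, he, not_le.1 hlt⟩

theorem Improvable.perm (π : Equiv.Perm (Fin 4))
    (h : Improvable (fun i => v (π i)) (fun i => π.symm (a i)) (fun i => X (π i))) :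
    Improvable v a X := by
  obtain ⟨Y, h1, h2, k, h3, h4⟩ := h
  refine ⟨fun i => Y (π.symm i), fun i j hij => h1 _ _ (by simpa using hij), ?_, k, ?_, ?_⟩
  · rintro i j hij ⟨e, he, h⟩
    exact h2 (π.symm i) (π.symm j) (by simpa using hij) ⟨e, he, by simpa using h⟩
  · simpa using h3
  · simpa using h4

end Levels

/-- The standing assumptions on the valuations, the ordering and the allocation. -/
structure Setting {ι : Type*} [DecidableEq ι] (v : Fin 4 → Finset ι → ℝ) (a : Fin 4 → Fin 4)
    (X : Fin 4 → Finset ι) : Prop where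
  val : ∀ i, IsValuation (v i)
  nd : ∀ i, NonDegenerate (v i)
  canc : ∀ i, Cancelable (v i)
  bij : Function.Bijective a
  disj : IsPartialAlloc X
  efx : IsEFX v X

namespace Setting

variable {ι : Type*} [DecidableEq ι] {v : Fin 4 → Finset ι → ℝ} {a : Fin 4 → Fin 4}
  {X : Fin 4 → Finset ι}

theorem mono (S : Setting v a X) (i : Fin 4) {A B : Finset ι} (h : A ⊆ B) : v i A ≤ v i B :=
  (S.val i).2.2 h

theorem eq_of_mem (S : Setting v a X) {i j : Fin 4} {e : ι} (hi : e ∈ X i) (hj : e ∈ X j) :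
    i = j := by
  by_contra hij
  exact Finset.disjoint_left.1 (S.disj i j hij) hi hj

theorem safe_own (S : Setting v a X) (j : Fin 4) : Safe v (fun i => v i (X i)) (X j) :=
  FairDivision.safe_own S.val S.efx j

theorem perm (S : Setting v a X) (π : Equiv.Perm (Fin 4)) :
    Setting (fun i => v (π i)) (fun i => π.symm (a i)) (fun i => X (π i)) where
  val i := S.val _
  nd i := S.nd _
  canc i := S.canc _
  bij := π.symm.bijective.comp S.bij
  disj i j hij := S.disj _ _ (by simpa using hij)
  efx i j hij := S.efx _ _ (by simpa using hij)

/-- A Pareto improvement by safe bundles is an improvement. -/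
theorem improvable_of_pareto (S : Setting v a X) {Y : Fin 4 → Finset ι}
    (hsafe : ∀ i, Safe v (fun i => v i (X i)) (Y i)) (hle : ∀ i, v i (X i) ≤ v i (Y i))
    {k : Fin 4} (hk : EnviesSet v X k (Y k)) (hd : IsPartialAlloc Y) : Improvable v a X := by
  obtain ⟨k, rfl⟩ := S.bij.2 k
  exact ⟨Y, hd, isEFX_of_safe hsafe hle, dominates_of_le k (fun j _ => hle _) hk⟩

/-- Giving safe envied bundles to the agents of `D` improves the allocation. -/
theorem improvable_of_cover (S : Setting v a X) {D : Finset (Fin 4)} (hD : D.Nonempty)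
    {Z : Fin 4 → Finset ι} (hs : ∀ k ∈ D, Safe v (fun i => v i (X i)) (Z k))
    (hE : ∀ k ∈ D, EnviesSet v X k (Z k))
    (hd : ∀ k ∈ D, ∀ j ∈ D, k ≠ j → Disjoint (Z k) (Z j))
    (hX : ∀ k ∈ D, ∀ j ∉ D, Disjoint (Z k) (X j)) : Improvable v a X := by
  obtain ⟨k, hk⟩ := hD
  refine S.improvable_of_pareto (Y := fun i => if i ∈ D then Z i else X i) (k := k) ?_ ?_ ?_ ?_
  · intro i
    by_cases hi : i ∈ D
    · simpa [hi] using hs i hi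
    · simpa [hi] using S.safe_own i
  · intro i
    by_cases hi : i ∈ D
    · simpa [hi] using (hE i hi).le
    · simp [hi]
  · simpa [hk] using hE k hk
  · intro i j hij
    by_cases hi : i ∈ D <;> by_cases hj : j ∈ D <;> simp only [hi, hj, if_true, if_false]
    · exact hd i hi j hj hij
    · exact hX i hi j hj
    · exact (hX j hj i hi).symm
    · exact S.disj i j hij

/-- If every agent `i` owns a safe bundle, apart from the goods of the others, which is envied
by some agent `f i`, then passing these bundles along a cycle of `f` is an improvement. -/
theorem improvable_of_cycle (S : Setting v a X) {Z : Fin 4 → Finset ι} {f : Fin 4 → Fin 4}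
    (hs : ∀ k, Safe v (fun i => v i (X i)) (Z k)) (hE : ∀ k, EnviesSet v X (f k) (Z k))
    (hd : ∀ k j, k ≠ j → Disjoint (Z k) (Z j)) (hX : ∀ k j, k ≠ j → Disjoint (Z k) (X j)) :
    Improvable v a X := by
  obtain ⟨D, ⟨hD, hDf⟩, hmin⟩ := WellFounded.has_min
    (wellFounded_lt (α := Finset (Fin 4))) {D | D.Nonempty ∧ D.image f ⊆ D}
    ⟨Finset.univ, by simp⟩
  have himg : D.image f = D := by
    by_contra hne
    exact hmin (D.image f) ⟨hD.image f, Finset.image_subset_image hDf⟩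
      (hDf.ssubset_of_ne hne)
  have hpre : ∀ k ∈ D, ∃ i ∈ D, f i = k := fun k hk => by
    rw [← himg] at hk
    simpa using hk
  choose! p hp hfp using hpre
  refine S.improvable_of_cover hD (Z := fun k => Z (p k)) (fun k _ => hs _)
    (fun k hk => by simpa [hfp k hk] using hE (p k)) ?_ ?_
  · intro k hk j hj hkj
    exact hd _ _ fun h => hkj (by rw [← hfp k hk, ← hfp j hj, h])
  · intro k hk j hj
    exact hX _ _ fun h => hj (h ▸ hp k hk)

theorem exists_safe_insert (S : Setting v a X) (s : Fin 4) {x : ι} (hx : x ∉ X s) :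
    ∃ Z ⊆ insert x (X s), Safe v (fun i => v i (X i)) Z ∧ ∃ c, EnviesSet v X c Z :=
  exists_safe_envied (fun i => v i (X i)) _ s
    ((S.nd s).lt_of_ssubset (S.val s) (Finset.ssubset_insert hx))

/-- A minimal envied subset of the bundle of an unenvied agent with an unallocated item. -/
theorem exists_champion_set (S : Setting v a X) {s : Fin 4} (hs : ∀ k, ¬ EnviesSet v X k (X s))
    {x : ι} (hx : x ∉ X s) : ∃ T ⊆ X s, Safe v (fun i => v i (X i)) (insert x T) ∧
      ∃ c, EnviesSet v X c (insert x T) := by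
  obtain ⟨Z, hZ, hsafe, c, hc⟩ := S.exists_safe_insert s hx
  have hxZ : x ∈ Z := by
    by_contra hxZ
    have hsub : Z ⊆ X s := (Finset.subset_insert_iff_of_notMem hxZ).1 hZ
    exact hs c (lt_of_lt_of_le hc (S.mono c hsub))
  refine ⟨Z.erase x, Finset.subset_insert_iff.1 hZ, ?_, c, ?_⟩
  · rwa [Finset.insert_erase hxZ]
  · rwa [Finset.insert_erase hxZ]

/-- An allocation with at most two unenvied agents is improvable. -/
theorem improvable_of_few_sources (S : Setting v a X) {g h : ι} (hgh : g ≠ h)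
    (hg : ∀ i, g ∉ X i) (hh : ∀ i, h ∉ X i) {s t : Fin 4}
    (hst : ∀ i, i ≠ s → i ≠ t → ∃ k, EnviesSet v X k (X i)) : Improvable v a X := by
  have key : ∀ i, ∃ Z c, (Z ⊆ X i ∪ (if i = s then {g} else if i = t then {h} else ∅)) ∧
      Safe v (fun i => v i (X i)) Z ∧ EnviesSet v X c Z := by
    intro i
    by_cases his : i = s
    · obtain ⟨Z, h1, h2, c, h3⟩ := S.exists_safe_insert i (hg i)
      exact ⟨Z, c, by simpa [his, Finset.union_comm] using his ▸ h1, h2, h3⟩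
    · by_cases hit : i = t
      · obtain ⟨Z, h1, h2, c, h3⟩ := S.exists_safe_insert i (hh i)
        refine ⟨Z, c, ?_, h2, h3⟩
        rw [if_neg his, if_pos hit, Finset.union_comm]
        exact h1
      · obtain ⟨k, hk⟩ := hst i his hit
        exact ⟨X i, k, by simp, S.safe_own i, hk⟩
  choose Z c hZ hsafe hE using key
  have hmem : ∀ i e, e ∈ Z i → e ∈ X i ∨ (i = s ∧ e = g) ∨ (i ≠ s ∧ i = t ∧ e = h) := by
    intro i e he
    have := hZ i he
    grind
  refine S.improvable_of_cycle hsafe hE ?_ ?_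
  · intro k j hkj
    rw [Finset.disjoint_left]
    intro e hk hj
    rcases hmem _ _ hk with h1 | h1 | h1 <;> rcases hmem _ _ hj with h2 | h2 | h2
    · exact hkj (S.eq_of_mem h1 h2)
    all_goals grind
  · intro k j hkj
    rw [Finset.disjoint_left]
    intro e hk hj
    rcases hmem _ _ hk with h1 | h1 | h1
    · exact hkj (S.eq_of_mem h1 hj)
    all_goals grind

end Setting

/-- Combinatorial data of an envy-free allocation in which two items are left over.  An index
`(y, none)` stands for the unallocated item `y`, and `(y, some i)` for the set of goods of `i`
which the champion set of `i` for the item `y` discards; `w k` is the value of these sets to `k`.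
`E k x s l` says that agent `k` envies the union of what the champion set of `s` for the item `x`
keeps of the bundle of `s` with the set `l`, and `C k x s l` that `k` is a most envious agent of
that union. -/
structure ChampionModel where
  w : Fin 4 → Bool × Option (Fin 4) → ℝ
  E : Fin 4 → Bool → Fin 4 → Bool × Option (Fin 4) → Prop
  C : Fin 4 → Bool → Fin 4 → Bool × Option (Fin 4) → Prop
  mono : ∀ {k x s l l'}, E k x s l → w k l ≤ w k l' → l.2 ≠ some s → l'.2 ≠ some s → E k x s l'
  lt_of_E : ∀ {k x s l}, l.2 ≠ some s → E k x s l → w k (x, some s) < w k l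
  E_self : ∀ {k x l}, l.2 ≠ some k → w k (x, some k) < w k l → E k x k l
  E_of_C : ∀ {k x s l}, C k x s l → E k x s l
  exists_C : ∀ {k x s l}, E k x s l → ∃ j, C j x s l
  C_of_E : ∀ {k x s}, E k x s (x, none) → C k x s (x, none)
  exists_E : ∀ x s, ∃ k, E k x s (x, none)
  no_cover : ∀ (D : Finset (Fin 4)) (σ : Fin 4 → Fin 4) (x : Fin 4 → Bool)
    (l : Fin 4 → Bool × Option (Fin 4)), D.Nonempty →
    (∀ k ∈ D, σ k ∈ D ∧ (∀ j ∈ D, j ≠ k → σ j ≠ σ k ∧ l j ≠ l k) ∧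
      ∀ i, (l k).2 = some i → i ∈ D ∧ i ≠ σ k ∧ (l k).1 = x i) →
    ¬ ∀ k ∈ D, C k (x (σ k)) (σ k) (l k)

namespace ChampionModel

variable (M : ChampionModel)

theorem not_C_item (k : Fin 4) (x : Bool) : ¬ M.C k x k (x, none) := fun h =>
  M.no_cover {k} (fun _ => k) (fun _ => x) (fun _ => (x, none)) ⟨k, by simp⟩ (by simp) (by simpa)

theorem w_item_le (k : Fin 4) (x : Bool) : M.w k (x, none) ≤ M.w k (x, some k) := by
  by_contra h
  exact M.not_C_item k x (M.C_of_E (M.E_self (by simp) (not_le.1 h)))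

theorem C_or {k x s l} (h : M.E k x s l) :
    M.C 0 x s l ∨ M.C 1 x s l ∨ M.C 2 x s l ∨ M.C 3 x s l := by
  obtain ⟨j, hj⟩ := M.exists_C h
  fin_cases j <;> simp_all

end ChampionModel

/-- Statements about a champion model from which the combinatorial refutations start. -/
inductive Fact
  | champ (k : Fin 4) (t : Bool × Fin 4) (l : Bool × Option (Fin 4))
  | envy (k : Fin 4) (t : Bool × Fin 4) (l : Bool × Option (Fin 4))
  | lt (k : Fin 4) (a b : Bool × Option (Fin 4))
  | le (k : Fin 4) (a b : Bool × Option (Fin 4))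
deriving DecidableEq

/-- The meaning of a fact in a champion model. -/
def Fact.Holds (M : ChampionModel) : Fact → Prop
  | champ k t l => M.C k t.1 t.2 l
  | envy k t l => M.E k t.1 t.2 l
  | lt k a b => M.w k a < M.w k b
  | le k a b => M.w k a ≤ M.w k b

/-- Refutations of a list of facts. -/
inductive Refutation
  /-- The listed champions can be served simultaneously. -/
  | cover (L : List (Fin 4 × (Bool × Fin 4) × (Bool × Option (Fin 4))))
  /-- The agents `i` and `j` are champions of each other for the item `x`. -/
  | swap (x : Bool) (i j : Fin 4)
  /-- The values of agent `k` increase along a closed path. -/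
  | loop (k : Fin 4) (a : Bool × Option (Fin 4)) (p : List (Bool × Option (Fin 4)))
  /-- Agent `k` envies the union with the last set of the path. -/
  | envy (k : Fin 4) (t : Bool × Fin 4) (a : Bool × Option (Fin 4))
      (p : List (Bool × Option (Fin 4))) (c : Refutation)
  /-- Case distinction on the champion of a union that agent `k` envies. -/
  | split (k : Fin 4) (t : Bool × Fin 4) (l : Bool × Option (Fin 4)) (c₀ c₁ c₂ c₃ : Refutation)
  /-- Case distinction on which of two sets agent `k` prefers. -/
  | compare (k : Fin 4) (a b : Bool × Option (Fin 4)) (c₁ c₂ : Refutation)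

namespace Refutation

/-- The context extended by the fact that `k` envies the union of `t` and `l`. -/
def addEnvy (Γ : List Fact) (k : Fin 4) (t : Bool × Fin 4) (l : Bool × Option (Fin 4)) :
    List Fact :=
  .lt k (t.1, some t.2) l :: .envy k t l :: if l = (t.1, none) then .champ k t l :: Γ else Γ

/-- The context extended by the fact that `k` is a champion of the union of `t` and `l`. -/
def addChamp (Γ : List Fact) (k : Fin 4) (t : Bool × Fin 4) (l : Bool × Option (Fin 4)) :
    List Fact :=
  .champ k t l :: addEnvy Γ k t l

/-- A step along which the value of agent `k` does not decrease. -/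
def leStep (Γ : List Fact) (k : Fin 4) (a b : Bool × Option (Fin 4)) : Bool :=
  decide (.lt k a b ∈ Γ) || decide (.le k a b ∈ Γ) || decide (b = (a.1, some k) ∧ a.2 = none)

/-- The value of agent `k` does not decrease along a path. -/
def lePath (Γ : List Fact) (k : Fin 4) : Bool × Option (Fin 4) → List (Bool × Option (Fin 4)) → Bool
  | _, [] => true
  | a, b :: p => leStep Γ k a b && lePath Γ k b p

/-- The value of agent `k` increases along a path. -/
def ltPath (Γ : List Fact) (k : Fin 4) : Bool × Option (Fin 4) → List (Bool × Option (Fin 4)) → Bool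
  | _, [] => false
  | a, b :: p => decide (.lt k a b ∈ Γ) && lePath Γ k b p || leStep Γ k a b && ltPath Γ k b p

/-- The entry of agent `k` in a list of champions. -/
def entry (L : List (Fin 4 × (Bool × Fin 4) × (Bool × Option (Fin 4)))) (k : Fin 4) :
    (Bool × Fin 4) × (Bool × Option (Fin 4)) :=
  ((L.find? fun e => e.1 = k).map Prod.snd).getD ((false, 0), (false, none))

/-- The item for which the champion set of agent `i` occurs in a list of champions. -/
def letter (L : List (Fin 4 × (Bool × Fin 4) × (Bool × Option (Fin 4)))) (i : Fin 4) : Bool :=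
  ((L.find? fun e => e.2.1.2 = i).map fun e => e.2.1.1).getD false

/-- Whether a refutation is valid in a context; `b` tells whether `swap` may be used. -/
def check (b : Bool) : List Fact → Refutation → Bool
  | Γ, cover L => !L.isEmpty && decide (∀ k ∈ L.map Prod.fst, (entry L k).1.2 ∈ L.map Prod.fst) &&
      decide (∀ k ∈ L.map Prod.fst, ∀ j ∈ L.map Prod.fst, j ≠ k →
        (entry L j).1.2 ≠ (entry L k).1.2 ∧ (entry L j).2 ≠ (entry L k).2) &&
      decide (∀ k ∈ L.map Prod.fst, ∀ i, (entry L k).2.2 = some i →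
          i ∈ L.map Prod.fst ∧ i ≠ (entry L k).1.2 ∧ (entry L k).2.1 = letter L i) &&
      decide (∀ k ∈ L.map Prod.fst,
        Fact.champ k (letter L (entry L k).1.2, (entry L k).1.2) (entry L k).2 ∈ Γ)
  | Γ, swap x i j => b && decide (.champ i (x, j) (x, none) ∈ Γ) &&
      decide (.champ j (x, i) (x, none) ∈ Γ)
  | Γ, loop k a p => ltPath Γ k a p && decide (p.getLastD a = a)
  | Γ, envy k t a p c => decide ((p.getLastD a).2 ≠ some t.2) &&
      (decide (a.2 ≠ some t.2) && decide (.envy k t a ∈ Γ) && lePath Γ k a p ||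
        decide (t.2 = k) && decide (a = (t.1, some k)) && ltPath Γ k a p) &&
      check b (addEnvy Γ k t (p.getLastD a)) c
  | Γ, split k t l c₀ c₁ c₂ c₃ => decide (l.2 ≠ some t.2) &&
      (decide (l = (t.1, none)) || decide (.envy k t l ∈ Γ)) &&
      check b (addChamp Γ 0 t l) c₀ && check b (addChamp Γ 1 t l) c₁ &&
      check b (addChamp Γ 2 t l) c₂ && check b (addChamp Γ 3 t l) c₃
  | Γ, compare k a b' c₁ c₂ => check b (.lt k a b' :: Γ) c₁ && check b (.le k b' a :: Γ) c₂

variable {M : ChampionModel} {Γ : List Fact}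

theorem holds_addEnvy (hΓ : ∀ f ∈ Γ, f.Holds M) {k t l} (hl : l.2 ≠ some t.2)
    (h : M.E k t.1 t.2 l) : ∀ f ∈ addEnvy Γ k t l, f.Holds M := by
  intro f hf
  simp only [addEnvy, List.mem_cons] at hf
  rcases hf with rfl | rfl | hf
  · exact M.lt_of_E hl h
  · exact h
  · split_ifs at hf with hi
    · rcases List.mem_cons.1 hf with rfl | hf
      · subst hi
        exact M.C_of_E h
      · exact hΓ f hf
    · exact hΓ f hf

theorem holds_addChamp (hΓ : ∀ f ∈ Γ, f.Holds M) {k t l} (hl : l.2 ≠ some t.2)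
    (h : M.C k t.1 t.2 l) : ∀ f ∈ addChamp Γ k t l, f.Holds M := by
  intro f hf
  rcases List.mem_cons.1 hf with rfl | hf
  · exact h
  · exact holds_addEnvy hΓ hl (M.E_of_C h) f hf

theorem le_of_leStep (hΓ : ∀ f ∈ Γ, f.Holds M) {k a b} (h : leStep Γ k a b = true) :
    M.w k a ≤ M.w k b := by
  simp only [leStep, Bool.or_eq_true, decide_eq_true_eq] at h
  rcases h with (h | h) | ⟨h, h'⟩
  · exact le_of_lt (hΓ _ h)
  · exact hΓ _ h
  · obtain ⟨x, o⟩ := a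
    obtain rfl : o = none := h'
    exact h ▸ M.w_item_le k x

theorem le_of_lePath (hΓ : ∀ f ∈ Γ, f.Holds M) {k} : ∀ {a p}, lePath Γ k a p = true →
    M.w k a ≤ M.w k (p.getLastD a)
  | _, [], _ => le_rfl
  | a, b :: p, h => by
    simp only [lePath, Bool.and_eq_true] at h
    simpa only [List.getLastD_cons] using (le_of_leStep hΓ h.1).trans (le_of_lePath hΓ h.2)

theorem lt_of_ltPath (hΓ : ∀ f ∈ Γ, f.Holds M) {k} : ∀ {a p}, ltPath Γ k a p = true →
    M.w k a < M.w k (p.getLastD a)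
  | _, [], h => by simp [ltPath] at h
  | a, b :: p, h => by
    simp only [ltPath, Bool.or_eq_true, Bool.and_eq_true, decide_eq_true_eq] at h
    rcases h with ⟨h, h'⟩ | ⟨h, h'⟩
    · simpa only [List.getLastD_cons] using lt_of_lt_of_le (hΓ _ h) (le_of_lePath hΓ h')
    · simpa only [List.getLastD_cons] using lt_of_le_of_lt (le_of_leStep hΓ h) (lt_of_ltPath hΓ h')

/-- A valid refutation shows that its context is contradictory. -/
theorem not_check {b : Bool}
    (hb : b = true → ∀ x i j, M.C i x j (x, none) → ¬ M.C j x i (x, none)) (c : Refutation) :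
    ∀ Γ : List Fact, (∀ f ∈ Γ, f.Holds M) → ¬ check b Γ c = true := by
  induction c with
  | cover L =>
    intro Γ hΓ h
    simp only [check, Bool.and_eq_true, decide_eq_true_eq] at h
    obtain ⟨⟨⟨⟨hL, h1⟩, h2⟩, h3⟩, h4⟩ := h
    simp only [← List.mem_toFinset] at h1 h2 h3
    refine M.no_cover (L.map Prod.fst).toFinset (fun k => (entry L k).1.2) (letter L)
      (fun k => (entry L k).2) ?_ (fun k hk => ⟨h1 k hk, h2 k hk, h3 k hk⟩)
      fun k hk => hΓ _ (h4 k (List.mem_toFinset.1 hk))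
    cases L <;> simp_all
  | swap x i j =>
    intro Γ hΓ h
    simp only [check, Bool.and_eq_true, decide_eq_true_eq] at h
    exact hb h.1.1 x i j (hΓ _ h.1.2) (hΓ _ h.2)
  | loop k a p =>
    intro Γ hΓ h
    simp only [check, Bool.and_eq_true, decide_eq_true_eq] at h
    exact absurd (h.2 ▸ lt_of_ltPath hΓ h.1) (lt_irrefl _)
  | envy k t a p c ih =>
    intro Γ hΓ h
    simp only [check, Bool.and_eq_true, Bool.or_eq_true, decide_eq_true_eq] at h
    refine ih _ (holds_addEnvy hΓ h.1.1 ?_) h.2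
    rcases h.1.2 with ⟨⟨h1, h2⟩, h3⟩ | ⟨⟨h1, h2⟩, h3⟩
    · exact M.mono (hΓ _ h2) (le_of_lePath hΓ h3) h1 h.1.1
    · subst h1
      refine M.E_self h.1.1 ?_
      rw [← h2]
      exact lt_of_ltPath hΓ h3
  | split k t l c₀ c₁ c₂ c₃ ih₀ ih₁ ih₂ ih₃ =>
    intro Γ hΓ h
    simp only [check, Bool.and_eq_true, Bool.or_eq_true, decide_eq_true_eq] at h
    have hE : ∃ j, M.E j t.1 t.2 l := by
      rcases h.1.1.1.1.2 with h' | h'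
      · subst h'
        exact M.exists_E _ _
      · exact ⟨k, hΓ _ h'⟩
    obtain ⟨j, hj⟩ := hE
    have hl := h.1.1.1.1.1
    rcases M.C_or hj with h' | h' | h' | h'
    · exact ih₀ _ (holds_addChamp hΓ hl h') h.1.1.1.2
    · exact ih₁ _ (holds_addChamp hΓ hl h') h.1.1.2
    · exact ih₂ _ (holds_addChamp hΓ hl h') h.1.2
    · exact ih₃ _ (holds_addChamp hΓ hl h') h.2
  | compare k a b' c₁ c₂ ih₁ ih₂ =>
    intro Γ hΓ h
    simp only [check, Bool.and_eq_true] at h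
    rcases lt_or_ge (M.w k a) (M.w k b') with h' | h'
    · exact ih₁ (.lt k a b' :: Γ) (List.forall_mem_cons.2 ⟨h', hΓ⟩) h.1
    · exact ih₂ (.le k b' a :: Γ) (List.forall_mem_cons.2 ⟨h', hΓ⟩) h.2

end Refutation

namespace Refutation
variable {M : ChampionModel} {Γ : List Fact}
/-- The context in which the champions of the unions with the item `x` are given by `G`. -/
def addChamps (Γ : List Fact) (x : Bool) (G : Fin 4 → Option (Fin 4)) : List Fact :=
  (List.finRange 4).foldl (fun Γ s => ((G s).map fun k => addChamp Γ k (x, s) (x, none)).getD Γ) Γ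

theorem holds_addChamps (hΓ : ∀ f ∈ Γ, f.Holds M) {x G}
    (h : ∀ s k, G s = some k → M.C k x s (x, none)) : ∀ f ∈ addChamps Γ x G, f.Holds M := by
  unfold addChamps
  generalize List.finRange 4 = L
  induction L generalizing Γ with
  | nil => exact hΓ
  | cons s L ih =>
    refine ih (Γ := ((G s).map fun k => addChamp Γ k (x, s) (x, none)).getD Γ) ?_
    obtain hs | ⟨k, hs⟩ : G s = none ∨ ∃ k, G s = some k := by cases G s <;> simp
    · simpa only [hs, Option.map_none, Option.getD_none] using hΓ
    · simp only [hs, Option.map_some, Option.getD_some]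
      exact holds_addChamp hΓ (by simp) (h s k hs)

/-- The champion set of agent `0` for the first item. -/
def T1 : Bool × Fin 4 := (false, 0)

/-- The goods that the champion set `T1` discards. -/
def B1 : Bool × Option (Fin 4) := (false, some 0)

/-- The champion set of agent `0` for the second item. -/
def T1' : Bool × Fin 4 := (true, 0)

/-- The goods that the champion set `T1'` discards. -/
def B1' : Bool × Option (Fin 4) := (true, some 0)

/-- The champion set of agent `1` for the first item. -/
def T2 : Bool × Fin 4 := (false, 1)

/-- The goods that the champion set `T2` discards. -/
def B2 : Bool × Option (Fin 4) := (false, some 1)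

/-- The champion set of agent `1` for the second item. -/
def T2' : Bool × Fin 4 := (true, 1)

/-- The goods that the champion set `T2'` discards. -/
def B2' : Bool × Option (Fin 4) := (true, some 1)

/-- The champion set of agent `2` for the first item. -/
def T3 : Bool × Fin 4 := (false, 2)

/-- The goods that the champion set `T3` discards. -/
def B3 : Bool × Option (Fin 4) := (false, some 2)

/-- The champion set of agent `2` for the second item. -/
def T3' : Bool × Fin 4 := (true, 2)

/-- The goods that the champion set `T3'` discards. -/
def B3' : Bool × Option (Fin 4) := (true, some 2)

/-- The champion set of agent `3` for the first item. -/
def T4 : Bool × Fin 4 := (false, 3)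

/-- The goods that the champion set `T4` discards. -/
def B4 : Bool × Option (Fin 4) := (false, some 3)

/-- The champion set of agent `3` for the second item. -/
def T4' : Bool × Fin 4 := (true, 3)

/-- The goods that the champion set `T4'` discards. -/
def B4' : Bool × Option (Fin 4) := (true, some 3)

/-- The first item. -/
def g : Bool × Option (Fin 4) := (false, none)

/-- The second item. -/
def h : Bool × Option (Fin 4) := (true, none)

theorem check_swap_star : ∃ c, check false (addChamps [] false ![some 1, some 0, some 0, some 0]) c =
    true := ⟨
  .split 0 T1' h
   (.cover [(0, T1', h)])
   (.cover [(0, T2, g), (1, T1', h)])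
   (.cover [(0, T3, g), (2, T1', h)])
   (.cover [(0, T4, g), (3, T1', h)]), by decide +kernel⟩

theorem check_swap_two_swap : ∃ c, check false (addChamps [] false ![some 1, some 0, some 0, some 1]) c = true := ⟨
  .split 0 T1' h
   (.cover [(0, T1', h)])
   (.cover [(0, T2, g), (1, T1', h)])
   (.cover [(0, T3, g), (2, T1', h)])
   (.split 0 T2' h
    (.cover [(0, T2', h), (1, T1, g)])
    (.cover [(1, T2', h)])
    (.envy 1 T1 g [B2]
    (.split 1 T1 B2
     (.loop 0 B1 [B2, g, B1])
     (.cover [(0, T2, g), (1, T1, B2)])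
     (.envy 0 T2 g [B1]
     (.split 0 T2 B1
      (.cover [(0, T2, B1), (1, T1, g)])
      (.loop 1 B1 [g, B2, B1])
      (.loop 2 B1 [B2, B1])
      (.split 0 T3' h
       (.cover [(0, T3', h), (1, T4, g), (2, T1, B2), (3, T2, B1)])
       (.cover [(0, T2, g), (1, T3', h), (2, T1, B2)])
       (.cover [(2, T3', h)])
       (.split 0 T4' h
        (.envy 0 T4' h [B1']
        (.split 0 T4' B1'
         (.cover [(0, T4', B1'), (3, T1', h)])
         (.cover [(0, T2, g), (1, T4', B1'), (3, T1', h)])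
         (.cover [(0, T3, g), (2, T4', B1'), (3, T1', h)])
         (.loop 3 B1' [h, B4', B1'])))
        (.cover [(0, T3, g), (1, T4', h), (2, T1, B2), (3, T2, B1)])
        (.envy 2 T4' h [B3']
        (.split 2 T4' B3'
         (.envy 3 T3' h [B4']
         (.split 3 T3' B4'
          (.loop 0 B3' [B4', B3'])
          (.cover [(0, T4', B3'), (1, T3', B4'), (2, T1, B2), (3, T2, B1)])
          (.loop 2 B3' [B4', h, B3'])
          (.cover [(0, T4', B3'), (1, T1, g), (2, T2', h), (3, T3', B4')])))
         (.cover [(0, T2, g), (1, T4', B3'), (2, T1, B2), (3, T3', h)])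
         (.cover [(2, T4', B3'), (3, T3', h)])
         (.loop 3 B3' [h, B4', B3'])))
        (.cover [(3, T4', h)])))))
     (.envy 0 T2 g [B1]
     (.split 0 T2 B1
      (.cover [(0, T2, B1), (1, T1, g)])
      (.loop 1 B1 [g, B2, B1])
      (.split 0 T3' h
       (.cover [(0, T3', h), (1, T1, g), (2, T2, B1)])
       (.envy 1 T3' h [B2']
       (.split 1 T3' B2'
        (.envy 2 T2' h [B3']
        (.split 2 T2' B3'
         (.loop 0 B2' [B3', B2'])
         (.loop 1 B2' [B3', h, B2'])
         (.cover [(0, T3', B2'), (1, T1, g), (2, T2', B3')])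
         (.split 0 T4' h
          (.envy 0 T4' h [B1']
          (.split 0 T4' B1'
           (.cover [(0, T4', B1'), (3, T1', h)])
           (.cover [(0, T2, g), (1, T4', B1'), (3, T1', h)])
           (.cover [(0, T3, g), (2, T4', B1'), (3, T1', h)])
           (.loop 3 B1' [h, B4', B1'])))
          (.cover [(0, T2, g), (1, T4', h), (3, T1, B2)])
          (.cover [(0, T3', B2'), (1, T1, g), (2, T4', h), (3, T2', B3')])
          (.cover [(3, T4', h)]))))
        (.cover [(1, T3', B2'), (2, T2', h)])
        (.loop 2 B2' [h, B3', B2'])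
        (.cover [(1, T4, g), (2, T2', h), (3, T3', B2')])))
       (.cover [(2, T3', h)])
       (.split 0 T4' h
        (.envy 0 T4' h [B1']
        (.split 0 T4' B1'
         (.cover [(0, T4', B1'), (3, T1', h)])
         (.cover [(0, T2, g), (1, T4', B1'), (3, T1', h)])
         (.cover [(0, T3, g), (2, T4', B1'), (3, T1', h)])
         (.loop 3 B1' [h, B4', B1'])))
        (.cover [(0, T2, g), (1, T4', h), (3, T1, B2)])
        (.envy 3 T3' h [B4']
        (.split 3 T3' B4'
         (.envy 2 T4' h [B3']
         (.split 2 T4' B3'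
          (.loop 0 B3' [B4', B3'])
          (.cover [(0, T3', B4'), (1, T4', B3'), (2, T2, B1), (3, T1, B2)])
          (.cover [(0, T3', B4'), (2, T4', B3'), (3, T1', h)])
          (.cover [(0, T3', B4'), (1, T1, g), (2, T2', h), (3, T4', B3')])))
         (.cover [(0, T2, g), (1, T3', B4'), (2, T4', h), (3, T1, B2)])
         (.loop 2 B3' [B4', h, B3'])
         (.cover [(2, T4', h), (3, T3', B4')])))
        (.cover [(3, T4', h)])))
      (.loop 3 B1 [B2, B1])))))
    (.cover [(1, T4, g), (3, T2', h)])), by decide +kernel⟩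

theorem check_swap_path : ∃ c, check false (addChamps [] false ![some 1, some 0, some 0, some 2]) c = true := ⟨
  .split 0 T1' h
   (.cover [(0, T1', h)])
   (.cover [(0, T2, g), (1, T1', h)])
   (.cover [(0, T3, g), (2, T1', h)])
   (.split 0 T3' h
    (.envy 0 T2 g [B1]
    (.split 0 T2 B1
     (.cover [(0, T2, B1), (1, T1, g)])
     (.loop 1 B1 [g, B2, B1])
     (.cover [(0, T3', h), (1, T1, g), (2, T2, B1)])
     (.envy 1 T1 g [B2]
     (.split 1 T1 B2
      (.loop 0 B1 [B2, g, B1])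
      (.cover [(0, T2, g), (1, T1, B2)])
      (.split 0 T4' h
       (.cover [(0, T4', h), (1, T1, g), (3, T2, B1)])
       (.cover [(0, T3, g), (1, T4', h), (2, T1, B2), (3, T2, B1)])
       (.envy 2 T4' h [B3']
       (.split 2 T4' B3'
        (.envy 0 T4' B3' [h]
        (.cover [(0, T4', h), (1, T1, g), (3, T2, B1)]))
        (.cover [(0, T3', h), (1, T4', B3'), (2, T1, B2), (3, T2, B1)])
        (.cover [(0, T3', h), (1, T1, g), (2, T4', B3'), (3, T2, B1)])
        (.envy 3 T1' h [B4']
        (.envy 3 T1' B4' [B3']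
        (.split 3 T1' B3'
         (.loop 0 B1' [B3', h, B1'])
         (.envy 0 T3' h [B1']
         (.split 0 T3' B1'
          (.cover [(0, T3', B1'), (2, T4, g), (3, T1', h)])
          (.loop 1 B1' [B3', B1'])
          (.cover [(0, T2, g), (1, T1', B3'), (2, T3', B1')])
          (.loop 3 B1' [h, B4', B3', B1'])))
         (.cover [(0, T3', h), (2, T1', B3')])
         (.cover [(0, T3', h), (2, T4, g), (3, T1', B3')]))))))
       (.cover [(3, T4', h)]))
      (.loop 3 B1 [B2, B1])))))
    (.envy 1 T1 g [B2]
    (.split 1 T1 B2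
     (.loop 0 B1 [B2, g, B1])
     (.cover [(0, T2, g), (1, T1, B2)])
     (.cover [(0, T2, g), (1, T3', h), (2, T1, B2)])
     (.envy 0 T2 g [B1]
     (.split 0 T2 B1
      (.cover [(0, T2, B1), (1, T1, g)])
      (.loop 1 B1 [g, B2, B1])
      (.split 0 T2' h
       (.cover [(0, T2', h), (1, T1, g)])
       (.cover [(1, T2', h)])
       (.envy 2 T2' h [B3']
       (.split 2 T2' B3'
        (.envy 1 T3' h [B2']
        (.split 1 T3' B2'
         (.loop 0 B2' [B3', B2'])
         (.cover [(0, T2', B3'), (1, T3', B2'), (2, T4, g), (3, T1', h)])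
         (.cover [(0, T2', B3'), (1, T1, g), (2, T3', B2')])
         (.split 0 T4' h
          (.envy 0 T4' h [B1']
          (.split 0 T4' B1'
           (.cover [(0, T4', B1'), (3, T1', h)])
           (.cover [(0, T2, g), (1, T4', B1'), (3, T1', h)])
           (.cover [(0, T3, g), (2, T4', B1'), (3, T1', h)])
           (.loop 3 B1' [h, B4', B1'])))
          (.cover [(0, T2, g), (1, T4', h), (3, T1, B2)])
          (.cover [(0, T2', B3'), (1, T1, g), (2, T4', h), (3, T3', B2')])
          (.cover [(3, T4', h)]))))
        (.loop 1 B2' [B3', h, B2'])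
        (.cover [(1, T3', h), (2, T2', B3')])
        (.cover [(1, T3', h), (2, T4, g), (3, T2', B3')])))
       (.split 0 T4' h
        (.envy 0 T4' h [B1']
        (.split 0 T4' B1'
         (.cover [(0, T4', B1'), (3, T1', h)])
         (.cover [(0, T2, g), (1, T4', B1'), (3, T1', h)])
         (.cover [(0, T3, g), (2, T4', B1'), (3, T1', h)])
         (.loop 3 B1' [h, B4', B1'])))
        (.cover [(0, T2, g), (1, T4', h), (3, T1, B2)])
        (.envy 2 T4' h [B3']
        (.split 2 T4' B3'
         (.cover [(0, T4', B3'), (1, T3', h), (2, T2, B1), (3, T1, B2)])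
         (.envy 1 T4' B3' [h]
         (.cover [(0, T2, g), (1, T4', h), (3, T1, B2)]))
         (.cover [(0, T2, g), (1, T3', h), (2, T4', B3'), (3, T1, B2)])
         (.envy 3 T2' h [B4']
         (.envy 3 T2' B4' [B3']
         (.split 3 T2' B3'
          (.envy 1 T3' h [B2']
          (.split 1 T3' B2'
           (.loop 0 B2' [B3', B2'])
           (.cover [(0, T2', B3'), (1, T3', B2'), (2, T4, g), (3, T1', h)])
           (.cover [(0, T2', B3'), (1, T1, g), (2, T3', B2')])
           (.cover [(0, T2', B3'), (1, T1, g), (2, T4', h), (3, T3', B2')])))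
          (.loop 1 B2' [B3', h, B2'])
          (.cover [(1, T3', h), (2, T2', B3')])
          (.cover [(1, T3', h), (2, T4, g), (3, T2', B3')]))))))
        (.cover [(3, T4', h)])))
      (.loop 3 B1 [B2, B1])))))
    (.cover [(2, T3', h)])
    (.cover [(2, T4, g), (3, T3', h)])), by decide +kernel⟩

theorem check_two_swaps : ∃ c, check false (addChamps [] false ![some 1, some 0, some 3, some 2]) c = true := ⟨
  .split 0 T1' h
   (.cover [(0, T1', h)])
   (.cover [(0, T2, g), (1, T1', h)])
   (.envy 2 T4 g [B3]
   (.split 2 T4 B3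
    (.cover [(0, T4, B3), (2, T1', h), (3, T3, g)])
    (.envy 3 T3 g [B4]
    (.split 3 T3 B4
     (.compare 0 g B4
      (.split 0 T3' h
       (.envy 0 T2 g [B1]
       (.split 0 T2 B1
        (.cover [(0, T2, B1), (1, T1, g)])
        (.loop 1 B1 [g, B2, B1])
        (.cover [(0, T3', h), (1, T1, g), (2, T2, B1)])
        (.envy 1 T1 g [B2]
        (.split 1 T1 B2
         (.loop 0 B1 [B2, g, B1])
         (.cover [(0, T2, g), (1, T1, B2)])
         (.envy 2 T1' h [B3']
         (.split 2 T1' B3'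
          (.loop 0 B1' [B3', h, B1'])
          (.envy 0 T3' h [B1']
          (.split 0 T3' B1'
           (.cover [(0, T3', B1'), (2, T1', h)])
           (.cover [(0, T2, g), (1, T3', B1'), (2, T1', h)])
           (.cover [(0, T2, g), (1, T1', B3'), (2, T3', B1')])
           (.compare 2 B2 B4
            (.envy 2 T1 B2 [B4]
            (.envy 2 T1 B4 [g]
            (.cover [(0, T3', h), (2, T1, g)])))
            (.compare 2 B2 g
             (.envy 2 T1 B2 [g]
             (.cover [(0, T3', h), (2, T1, g)]))
             (.envy 2 T4 g [B2]
             (.split 2 T4 B2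
              (.loop 0 B2 [g, B4, B2])
              (.cover [(0, T2, g), (1, T4, B2), (2, T1', h), (3, T3', B1')])
              (.cover [(0, T3', h), (1, T1, g), (2, T4, B2), (3, T2, B1)])
              (.envy 0 T2 g [B4]
              (.split 0 T2 B4
               (.cover [(0, T2, B4), (1, T1, g), (3, T4, B2)])
               (.cover [(1, T2, B4), (3, T4, B2)])
               (.loop 2 B2 [B4, B2])
               (.loop 3 B2 [B4, B2])))))))))
          (.cover [(0, T3', h), (2, T1', B3')])
          (.cover [(0, T3', h), (2, T4, g), (3, T1', B3')])))
         (.loop 3 B1 [B2, B1])))))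
       (.envy 1 T1 g [B2]
       (.split 1 T1 B2
        (.loop 0 B1 [B2, g, B1])
        (.cover [(0, T2, g), (1, T1, B2)])
        (.cover [(0, T2, g), (1, T3', h), (2, T1, B2)])
        (.envy 0 T2 g [B4]
        (.split 0 T2 B4
         (.cover [(0, T2, B4), (1, T3', h), (2, T4, g), (3, T1, B2)])
         (.split 0 T4' h
          (.compare 3 B2 B3
           (.envy 3 T1 B2 [B3]
           (.envy 3 T1 B3 [g]
           (.cover [(0, T4', h), (3, T1, g)])))
           (.compare 3 B2 g
            (.envy 3 T1 B2 [g]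
            (.cover [(0, T4', h), (3, T1, g)]))
            (.envy 3 T3 g [B2]
            (.split 3 T3 B2
             (.envy 0 T3 B2 [g]
             (.cover [(0, T3, g), (2, T1', h)]))
             (.cover [(0, T2, g), (1, T3, B2), (2, T1', h)])
             (.envy 1 T2 B4 [B3]
             (.split 1 T2 B3
              (.cover [(0, T2, B3), (1, T1, g), (2, T3, B2)])
              (.cover [(1, T2, B3), (2, T3, B2)])
              (.loop 2 B2 [B3, B2])
              (.loop 3 B2 [B3, B2])))
             (.cover [(0, T2, g), (1, T4, B3), (2, T1', h), (3, T3, B2)])))))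
          (.cover [(0, T2, g), (1, T4', h), (3, T1, B2)])
          (.cover [(2, T4', h), (3, T3, g)])
          (.cover [(3, T4', h)]))
         (.envy 2 T2 B4 [g]
         (.cover [(1, T3', h), (2, T2, g)]))
         (.cover [(1, T3', h), (2, T4, g), (3, T2, B4)])))))
       (.cover [(2, T3', h)])
       (.cover [(2, T4, g), (3, T3', h)]))
      (.envy 0 T3 B4 [g]
      (.cover [(0, T3, g), (2, T1', h)])))
     (.loop 1 B3 [B4, B3])
     (.loop 2 B3 [B4, g, B3])
     (.cover [(2, T4, g), (3, T3, B4)])))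
    (.cover [(2, T4, B3), (3, T3, g)])
    (.loop 3 B3 [g, B4, B3])))
   (.envy 3 T3 g [B4]
   (.split 3 T3 B4
    (.cover [(0, T3, B4), (2, T4, g), (3, T1', h)])
    (.envy 2 T4 g [B3]
    (.split 2 T4 B3
     (.split 0 T2' h
      (.cover [(0, T2', h), (1, T1, g)])
      (.cover [(1, T2', h)])
      (.compare 1 g B4
       (.split 0 T3' h
        (.envy 1 T1 g [B4]
        (.split 1 T1 B4
         (.envy 0 T2 g [B1]
         (.split 0 T2 B1
          (.cover [(0, T2, B1), (1, T1, g)])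
          (.loop 1 B1 [g, B2, B1])
          (.cover [(0, T3', h), (1, T1, g), (2, T2, B1)])
          (.envy 1 T1 g [B2]
          (.split 1 T1 B2
           (.loop 0 B1 [B2, g, B1])
           (.cover [(0, T2, g), (1, T1, B2)])
           (.compare 2 B2 B4
            (.envy 2 T1 B2 [B4]
            (.envy 2 T1 B4 [g]
            (.cover [(0, T3', h), (2, T1, g)])))
            (.compare 2 B2 g
             (.envy 2 T1 B2 [g]
             (.cover [(0, T3', h), (2, T1, g)]))
             (.envy 2 T4 g [B2]
             (.split 2 T4 B2
              (.loop 0 B1 [B4, B2, g, B1])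
              (.cover [(0, T2, g), (1, T4, B2), (3, T1', h)])
              (.cover [(0, T2, g), (1, T3, B4), (2, T4, B2), (3, T1', h)])
              (.envy 0 T2 g [B1]
              (.envy 0 T2 B1 [B4]
              (.split 0 T2 B4
               (.cover [(0, T2, B4), (1, T1, g), (3, T4, B2)])
               (.cover [(1, T2, B4), (3, T4, B2)])
               (.loop 2 B2 [B4, B2])
               (.loop 3 B2 [B4, B2]))))))))
           (.loop 3 B1 [B2, B1])))))
         (.cover [(0, T4, B3), (1, T1, B4), (2, T2', h), (3, T3, g)])
         (.envy 2 T1 B4 [g]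
         (.cover [(0, T3', h), (2, T1, g)]))
         (.cover [(0, T3', h), (2, T4, g), (3, T1, B4)])))
        (.envy 1 T1 g [B2]
        (.split 1 T1 B2
         (.loop 0 B1 [B2, g, B1])
         (.cover [(0, T2, g), (1, T1, B2)])
         (.cover [(0, T2, g), (1, T3', h), (2, T1, B2)])
         (.envy 0 T2 g [B1]
         (.split 0 T2 B1
          (.cover [(0, T2, B1), (1, T1, g)])
          (.loop 1 B1 [g, B2, B1])
          (.envy 1 T3' h [B2']
          (.split 1 T3' B2'
           (.cover [(0, T3', B2'), (1, T1, g), (2, T2', h)])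
           (.cover [(1, T3', B2'), (2, T2', h)])
           (.loop 2 B2' [h, B3', B2'])
           (.compare 2 B1 B4
            (.envy 2 T2 B1 [B4]
            (.envy 2 T2 B4 [g]
            (.cover [(1, T3', h), (2, T2, g)])))
            (.compare 2 B1 g
             (.envy 2 T2 B1 [g]
             (.cover [(1, T3', h), (2, T2, g)]))
             (.envy 2 T4 g [B1]
             (.split 2 T4 B1
              (.cover [(0, T4, B1), (1, T1, g), (2, T2', h), (3, T3', B2')])
              (.cover [(0, T2, g), (1, T4, B1), (3, T1, B2)])
              (.cover [(0, T2, g), (1, T3', h), (2, T4, B1), (3, T1, B2)])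
              (.envy 1 T1 g [B4]
              (.split 1 T1 B4
               (.envy 0 T2 g [B1]
               (.envy 0 T2 B1 [B4]
               (.split 0 T2 B4
                (.cover [(0, T2, B4), (1, T1, g), (3, T4, B1)])
                (.envy 3 T4 B1 [B2]
                (.split 3 T4 B2
                 (.loop 0 B1 [B4, B2, g, B1])
                 (.cover [(0, T2, g), (1, T4, B2), (3, T1', h)])
                 (.cover [(0, T2, g), (1, T3, B4), (2, T4, B2), (3, T1', h)])
                 (.cover [(1, T2, B4), (3, T4, B2)])))
                (.envy 2 T2 B4 [g]
                (.cover [(1, T3', h), (2, T2, g)]))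
                (.cover [(1, T3', h), (2, T4, g), (3, T2, B4)]))))
               (.cover [(0, T2, g), (1, T1, B4), (3, T4, B1)])
               (.loop 2 B1 [B4, B1])
               (.loop 3 B1 [B4, B1])))))))))
          (.loop 3 B1 [B2, B1])))))
        (.cover [(2, T3', h)])
        (.cover [(2, T4, g), (3, T3', h)]))
       (.envy 1 T3 B4 [g]
       (.cover [(1, T3, g), (2, T2', h)])))
      (.cover [(1, T3, B4), (2, T4, g), (3, T2', h)]))
     (.loop 1 B3 [B4, B3])
     (.cover [(2, T4, B3), (3, T3, g)])
     (.loop 3 B3 [g, B4, B3])))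
    (.loop 2 B3 [B4, g, B3])
    (.cover [(2, T4, g), (3, T3, B4)]))), by decide +kernel⟩

theorem check_equal_cycles : ∃ c, check true (addChamps (addChamps [] false ![some 3, some 0, some 1, some 2]) true
    ![some 3, some 0, some 1, some 2]) c = true := ⟨
  .compare 3 B4 B2
   (.envy 3 T1 g [B4]
   (.envy 3 T1 B4 [B2]
   (.split 3 T1 B2
    (.loop 0 B1 [B2, g, B1])
    (.cover [(0, T2, g), (1, T1, B2)])
    (.cover [(0, T2, g), (1, T3', h), (2, T1, B2)])
    (.envy 0 T2 g [B1]
    (.split 0 T2 B1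
     (.cover [(0, T2, B1), (1, T3', h), (2, T4, g), (3, T1, B2)])
     (.envy 1 T3 g [B2]
     (.envy 1 T3 B2 [B1]
     (.split 1 T3 B1
      (.cover [(0, T3, B1), (2, T4', h), (3, T1, g)])
      (.cover [(0, T2, g), (1, T3, B1), (2, T4', h), (3, T1, B2)])
      (.envy 2 T4 g [B3]
      (.envy 2 T4 B3 [B1]
      (.split 2 T4 B1
       (.cover [(0, T4, B1), (3, T1, g)])
       (.cover [(0, T2', h), (1, T4, B1), (3, T1, g)])
       (.cover [(0, T2, g), (1, T3', h), (2, T4, B1), (3, T1, B2)])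
       (.loop 3 B1 [g, B4, B1]))))
      (.envy 3 T3 B1 [g]
      (.cover [(2, T4', h), (3, T3, g)])))))
     (.compare 2 B1 g
      (.envy 2 T2 B1 [g]
      (.cover [(1, T3', h), (2, T2, g)]))
      (.envy 2 T4 g [B1]
      (.split 2 T4 B1
       (.cover [(0, T4, B1), (3, T1, g)])
       (.cover [(0, T2', h), (1, T4, B1), (3, T1, g)])
       (.cover [(0, T2, g), (1, T3', h), (2, T4, B1), (3, T1, B2)])
       (.loop 3 B1 [g, B4, B1]))))
     (.loop 3 B1 [B2, B1]))))))
   (.compare 0 B1 B3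
    (.envy 0 T2 g [B1]
    (.envy 0 T2 B1 [B3]
    (.split 0 T2 B3
     (.envy 1 T3 g [B2]
     (.split 1 T3 B2
      (.loop 0 B2 [B3, B2])
      (.cover [(0, T2, B3), (1, T3, B2), (2, T4', h), (3, T1, g)])
      (.envy 2 T4 g [B3]
      (.envy 2 T4 B3 [B2]
      (.split 2 T4 B2
       (.envy 0 T4 B2 [g]
       (.cover [(0, T4, g), (3, T1', h)]))
       (.cover [(0, T2, g), (1, T4, B2), (3, T1', h)])
       (.cover [(0, T2, B3), (1, T3, g), (2, T4, B2), (3, T1', h)])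
       (.loop 3 B2 [B4, B2]))))
      (.envy 3 T3 B2 [B4]
      (.split 3 T3 B4
       (.cover [(0, T3, B4), (2, T4, g), (3, T1', h)])
       (.cover [(0, T2, B3), (1, T3, B4), (2, T4, g), (3, T1', h)])
       (.loop 2 B3 [B4, g, B3])
       (.cover [(2, T4, g), (3, T3, B4)])))))
     (.loop 1 B2 [B3, g, B2])
     (.cover [(1, T3, g), (2, T2, B3)])
     (.cover [(1, T3, g), (2, T4', h), (3, T2, B3)]))))
    (.compare 0 B1 B4
     (.envy 0 T2 g [B1]
     (.envy 0 T2 B1 [B4]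
     (.split 0 T2 B4
      (.envy 2 T4 g [B3]
      (.split 2 T4 B3
       (.loop 0 B1 [B4, B3, B1])
       (.envy 1 T4 B3 [g]
       (.cover [(0, T2, B4), (1, T4, g), (3, T1', h)]))
       (.cover [(0, T2, B4), (1, T3, g), (2, T4, B3), (3, T1', h)])
       (.envy 3 T1 g [B4]
       (.envy 3 T1 B4 [B3]
       (.split 3 T1 B3
        (.loop 0 B1 [B3, B1])
        (.envy 1 T1 B3 [g]
        (.cover [(0, T2', h), (1, T1, g)]))
        (.cover [(0, T2', h), (1, T3, g), (2, T1, B3)])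
        (.envy 1 T3 g [B2]
        (.split 1 T3 B2
         (.envy 0 T3 B2 [g]
         (.cover [(0, T3, g), (2, T4', h), (3, T1, B3)]))
         (.cover [(0, T2, B4), (1, T3, B2), (2, T4, g), (3, T1', h)])
         (.envy 2 T4 g [B3]
         (.envy 2 T4 B3 [B2]
         (.split 2 T4 B2
          (.loop 0 B2 [B4, B2])
          (.cover [(0, T2, B4), (1, T4, B2), (3, T1', h)])
          (.cover [(0, T2, B4), (1, T3', h), (2, T4, B2), (3, T1, g)])
          (.loop 3 B2 [B4, B2]))))
         (.loop 3 B2 [B4, B3, B2]))))))))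
      (.envy 1 T3 g [B2]
      (.envy 1 T3 B2 [B4]
      (.split 1 T3 B4
       (.cover [(0, T3, B4), (2, T4, g), (3, T1', h)])
       (.envy 2 T4 g [B3]
       (.split 2 T4 B3
        (.loop 0 B1 [B4, B3, B1])
        (.loop 1 B3 [B4, B3])
        (.cover [(0, T2', h), (1, T3, B4), (2, T4, B3), (3, T1, g)])
        (.envy 3 T1 g [B4]
        (.envy 3 T1 B4 [B3]
        (.split 3 T1 B3
         (.loop 0 B1 [B3, B1])
         (.envy 1 T1 B3 [g]
         (.cover [(0, T2', h), (1, T1, g)]))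
         (.cover [(0, T2', h), (1, T3, g), (2, T1, B3)])
         (.cover [(0, T2', h), (1, T3, B4), (2, T4, g), (3, T1, B3)]))))))
       (.loop 2 B3 [B4, g, B3])
       (.cover [(2, T4, g), (3, T3, B4)]))))
      (.envy 2 T2 B4 [g]
      (.cover [(1, T3', h), (2, T2, g)]))
      (.cover [(1, T3', h), (2, T4, g), (3, T2, B4)]))))
     (.envy 3 T1 g [B4]
     (.split 3 T1 B4
      (.loop 0 B1 [B4, B1])
      (.compare 1 B4 g
       (.envy 1 T1 B4 [g]
       (.cover [(0, T2', h), (1, T1, g)]))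
       (.envy 1 T3 g [B4]
       (.split 1 T3 B4
        (.cover [(0, T3, B4), (2, T4, g), (3, T1', h)])
        (.envy 2 T4 g [B3]
        (.split 2 T4 B3
         (.envy 0 T4 B3 [B1]
         (.split 0 T4 B1
          (.cover [(0, T4, B1), (3, T1, g)])
          (.cover [(0, T2', h), (1, T4, B1), (3, T1, g)])
          (.cover [(0, T2', h), (1, T3, B4), (2, T4, B1), (3, T1, g)])
          (.loop 3 B1 [g, B4, B1])))
         (.loop 1 B3 [B4, B3])
         (.cover [(0, T2', h), (1, T3, B4), (2, T4, B3), (3, T1, g)])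
         (.envy 3 T1 g [B4]
         (.envy 3 T1 B4 [B3]
         (.split 3 T1 B3
          (.loop 0 B1 [B3, B1])
          (.envy 1 T1 B3 [g]
          (.cover [(0, T2', h), (1, T1, g)]))
          (.cover [(0, T2', h), (1, T3, g), (2, T1, B3)])
          (.cover [(0, T2', h), (1, T3, B4), (2, T4, g), (3, T1, B3)]))))))
        (.loop 2 B3 [B4, g, B3])
        (.cover [(2, T4, g), (3, T3, B4)]))))
      (.envy 2 T1 B4 [g]
      (.envy 2 T1 g [B3]
      (.split 2 T1 B3
       (.loop 0 B1 [B3, B1])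
       (.envy 1 T1 B3 [g]
       (.cover [(0, T2', h), (1, T1, g)]))
       (.cover [(0, T2', h), (1, T3, g), (2, T1, B3)])
       (.envy 0 T2 g [B1]
       (.split 0 T2 B1
        (.cover [(0, T2, B1), (1, T3, g), (2, T4', h), (3, T1, B3)])
        (.envy 1 T3 g [B2]
        (.envy 1 T3 B2 [B1]
        (.split 1 T3 B1
         (.cover [(0, T3, B1), (2, T4', h), (3, T1, B3)])
         (.cover [(0, T2', h), (1, T3, B1), (2, T4, g), (3, T1, B3)])
         (.loop 2 B1 [B4, g, B3, B1])
         (.loop 3 B1 [B3, B1]))))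
        (.envy 2 T1 B4 [g]
        (.envy 2 T2 B1 [g]
        (.cover [(1, T3', h), (2, T2, g)])))
        (.envy 3 T2 B1 [B3]
        (.split 3 T2 B3
         (.envy 1 T3 g [B2]
         (.split 1 T3 B2
          (.loop 0 B2 [B3, B2])
          (.cover [(0, T2, B3), (1, T3, B2), (2, T4', h), (3, T1, g)])
          (.envy 2 T1 B4 [g]
          (.envy 2 T1 g [B3]
          (.envy 2 T1 B3 [B2]
          (.split 2 T1 B2
           (.loop 0 B1 [B2, B3, B1])
           (.cover [(0, T2, g), (1, T1, B2)])
           (.cover [(0, T2, B3), (1, T3, g), (2, T1, B2)])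
           (.cover [(0, T2, B3), (1, T3, g), (2, T4', h), (3, T1, B2)])))))
          (.loop 3 B1 [B3, B2, B1])))
         (.loop 1 B2 [B3, g, B2])
         (.cover [(1, T3, g), (2, T2, B3)])
         (.cover [(1, T3, g), (2, T4', h), (3, T2, B3)]))))))))
      (.envy 2 T4 g [B3]
      (.split 2 T4 B3
       (.envy 0 T4 B3 [B1]
       (.split 0 T4 B1
        (.cover [(0, T4, B1), (3, T1, B4)])
        (.cover [(0, T2', h), (1, T4, B1), (3, T1, g)])
        (.cover [(0, T2', h), (1, T3, g), (2, T4, B1), (3, T1, B4)])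
        (.loop 3 B1 [B4, B1])))
       (.envy 1 T4 B3 [g]
       (.cover [(0, T2', h), (1, T4, g), (3, T1, B4)]))
       (.cover [(0, T2', h), (1, T3, g), (2, T4, B3), (3, T1, B4)])
       (.envy 3 T1 B4 [B3]
       (.split 3 T1 B3
        (.loop 0 B1 [B3, B1])
        (.envy 1 T1 B3 [g]
        (.cover [(0, T2', h), (1, T1, g)]))
        (.cover [(0, T2', h), (1, T3, g), (2, T1, B3)])
        (.envy 1 T3 g [B2]
        (.split 1 T3 B2
         (.envy 0 T3 B2 [g]
         (.cover [(0, T3, g), (2, T4', h), (3, T1, B3)]))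
         (.cover [(0, T2, g), (1, T3, B2), (2, T4', h), (3, T1, B3)])
         (.envy 2 T4 g [B3]
         (.envy 2 T4 B3 [B2]
         (.split 2 T4 B2
          (.envy 0 T4 B2 [g]
          (.cover [(0, T4, g), (3, T1', h)]))
          (.cover [(0, T2, g), (1, T4, B2), (3, T1', h)])
          (.cover [(0, T2, g), (1, T3', h), (2, T4, B2), (3, T1, B4)])
          (.loop 3 B2 [B4, B2]))))
         (.loop 3 B2 [B4, B3, B2]))))))))))), by decide +kernel⟩

theorem check_cycle : ∃ c, check true (addChamps (addChamps [] false ![some 3, some 0, some 1, some 2]) true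
    ![some 2, none, some 1, some 2]) c = true := ⟨
  .split 0 T2' h
   (.envy 0 T2' h [B1']
   (.split 0 T2' B1'
    (.cover [(0, T2', B1'), (1, T3, g), (2, T1', h)])
    (.envy 1 T3' h [B2']
    (.envy 1 T3' B2' [B1']
    (.split 1 T3' B1'
     (.cover [(0, T3', B1'), (2, T1', h)])
     (.cover [(0, T2, g), (1, T3', B1'), (2, T1', h)])
     (.loop 2 B1' [h, B3', B1'])
     (.envy 2 T1' h [B3']
     (.split 2 T1' B3'
      (.cover [(0, T1', B3'), (2, T4', h), (3, T3', B1')])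
      (.loop 1 B1' [B3', h, B2', B1'])
      (.cover [(0, T2, g), (1, T3', h), (2, T1', B3')])
      (.loop 3 B1' [B3', B1']))))))
    (.envy 2 T2' B1' [h]
    (.swap true 1 2))
    (.envy 2 T1' h [B3']
    (.split 2 T1' B3'
     (.cover [(0, T1', B3'), (1, T3', h), (2, T4, g), (3, T2', B1')])
     (.envy 1 T1' B3' [h]
     (.swap true 0 1))
     (.cover [(0, T2, g), (1, T3', h), (2, T1', B3')])
     (.envy 1 T3' h [B2']
     (.split 1 T3' B2'
      (.envy 0 T2' h [B1']
      (.envy 0 T3' B2' [B1']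
      (.split 0 T3' B1'
       (.cover [(0, T3', B1'), (2, T1', h)])
       (.cover [(0, T2, g), (1, T3', B1'), (2, T1', h)])
       (.loop 2 B1' [h, B3', B1'])
       (.loop 3 B1' [B3', B1']))))
      (.cover [(0, T2', h), (1, T3', B2'), (2, T4, g), (3, T1', B3')])
      (.envy 2 T1' h [B3']
      (.envy 2 T1' B3' [B2']
      (.split 2 T1' B2'
       (.loop 0 B1' [B2', h, B1'])
       (.cover [(0, T2', h), (1, T1', B2')])
       (.cover [(0, T2', h), (1, T3, g), (2, T1', B2')])
       (.loop 3 B1' [B2', B1']))))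
      (.loop 3 B1' [B3', B2', B1'])))))))
   (.cover [(1, T2', h)])
   (.swap true 1 2)
   (.envy 1 T3' h [B2']
   (.split 1 T3' B2'
    (.envy 3 T2' h [B4']
    (.split 3 T2' B4'
     (.envy 0 T3' B2' [B4']
     (.split 0 T3' B4'
      (.cover [(0, T3', B4'), (2, T4', h), (3, T1, g)])
      (.envy 2 T4' h [B3']
      (.split 2 T4' B3'
       (.loop 0 B2' [B4', B3', B2'])
       (.loop 1 B3' [B4', B3'])
       (.cover [(1, T3', B4'), (2, T4', B3'), (3, T2', h)])
       (.envy 3 T2' h [B4']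
       (.envy 3 T2' B4' [B3']
       (.split 3 T2' B3'
        (.loop 0 B2' [B3', B2'])
        (.loop 1 B2' [B3', h, B2'])
        (.cover [(1, T3', h), (2, T2', B3')])
        (.cover [(1, T3', B4'), (2, T4', h), (3, T2', B3')]))))))
      (.loop 2 B3' [B4', h, B3'])
      (.cover [(2, T4', h), (3, T3', B4')])))
     (.cover [(0, T3', B2'), (1, T2', B4'), (2, T4', h), (3, T1, g)])
     (.envy 2 T2' B4' [h]
     (.swap true 1 2))
     (.cover [(1, T3, g), (2, T4', h), (3, T2', B4')])))
    (.cover [(1, T3', B2'), (2, T4, g), (3, T2', h)])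
    (.envy 2 T4' h [B3']
    (.envy 2 T4' B3' [B2']
    (.split 2 T4' B2'
     (.envy 3 T2' h [B4']
     (.split 3 T2' B4'
      (.loop 0 B2' [B4', B2'])
      (.cover [(0, T4', B2'), (1, T2', B4'), (3, T1, g)])
      (.loop 2 B2' [B4', h, B3', B2'])
      (.cover [(1, T3, g), (2, T4', h), (3, T2', B4')])))
     (.cover [(1, T4', B2'), (3, T2', h)])
     (.cover [(1, T3, g), (2, T4', B2'), (3, T2', h)])
     (.loop 3 B2' [h, B4', B2']))))
    (.envy 3 T3' B2' [h]
    (.swap true 2 3)))), by decide +kernel⟩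

theorem check_equal_triangles : ∃ c, check true (addChamps (addChamps [] false ![some 2, some 0, some 1, some 0]) true
    ![some 2, some 0, some 1, none]) c = true := ⟨
  .envy 2 T1' h [B3']
  (.split 2 T1' B3'
   (.envy 0 T2' h [B1']
   (.envy 0 T2' B1' [B3']
   (.split 0 T2' B3'
    (.cover [(0, T2', B3'), (1, T3', h), (2, T1, g)])
    (.loop 1 B2' [B3', h, B2'])
    (.cover [(1, T3', h), (2, T2', B3')])
    (.envy 1 T3' h [B2']
    (.split 1 T3' B2'
     (.loop 0 B1' [B3', B2', h, B1'])
     (.cover [(0, T2', h), (1, T3', B2'), (2, T1, g)])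
     (.envy 2 T1' h [B3']
     (.envy 2 T1' B3' [B2']
     (.split 2 T1' B2'
      (.loop 0 B1' [B2', h, B1'])
      (.cover [(0, T2', h), (1, T1', B2')])
      (.cover [(0, T2', h), (1, T3, g), (2, T1', B2')])
      (.envy 0 T2' h [B1']
      (.split 0 T2' B1'
       (.cover [(0, T2', B1'), (1, T3, g), (2, T1', h)])
       (.envy 1 T3' h [B2']
       (.envy 1 T3' B2' [B1']
       (.split 1 T3' B1'
        (.cover [(0, T3', B1'), (2, T1', h)])
        (.cover [(0, T2, g), (1, T3', B1'), (2, T1', h)])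
        (.loop 2 B1' [h, B3', B1'])
        (.cover [(0, T4, g), (2, T1', h), (3, T3', B1')]))))
       (.loop 2 B1' [h, B3', B2', B1'])
       (.loop 3 B1' [B2', B1']))))))
     (.loop 3 B2' [B3', B2']))))))
   (.envy 1 T1' B3' [h]
   (.cover [(0, T2, g), (1, T1', h)]))
   (.cover [(0, T2, g), (1, T3', h), (2, T1', B3')])
   (.envy 0 T2' h [B1']
   (.split 0 T2' B1'
    (.cover [(0, T2', B1'), (1, T3, g), (2, T1', h)])
    (.envy 1 T3' h [B2']
    (.envy 1 T3' B2' [B1']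
    (.split 1 T3' B1'
     (.cover [(0, T3', B1'), (2, T1', h)])
     (.cover [(0, T2, g), (1, T3', B1'), (2, T1', h)])
     (.loop 2 B1' [h, B3', B1'])
     (.cover [(0, T4, g), (2, T1', h), (3, T3', B1')]))))
    (.envy 2 T2' B1' [h]
    (.swap true 1 2))
    (.envy 3 T2' B1' [B3']
    (.split 3 T2' B3'
     (.cover [(0, T2', B3'), (1, T3', h), (2, T1, g)])
     (.loop 1 B2' [B3', h, B2'])
     (.cover [(1, T3', h), (2, T2', B3')])
     (.envy 1 T3' h [B2']
     (.split 1 T3' B2'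
      (.envy 0 T2' h [B1']
      (.envy 0 T3' B2' [B1']
      (.split 0 T3' B1'
       (.cover [(0, T3', B1'), (2, T1', h)])
       (.cover [(0, T2, g), (1, T3', B1'), (2, T1', h)])
       (.loop 2 B1' [h, B3', B1'])
       (.cover [(0, T4, g), (2, T1', h), (3, T3', B1')]))))
      (.cover [(0, T2', h), (1, T3', B2'), (2, T1, g)])
      (.envy 2 T1' h [B3']
      (.envy 2 T1' B3' [B2']
      (.split 2 T1' B2'
       (.loop 0 B1' [B2', h, B1'])
       (.cover [(0, T2', h), (1, T1', B2')])
       (.cover [(0, T2', h), (1, T3, g), (2, T1', B2')])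
       (.loop 3 B1' [B2', B1']))))
      (.loop 3 B2' [B3', B2'])))))))), by decide +kernel⟩

theorem check_triangle_fst : ∃ c, check true (addChamps (addChamps [] false ![some 2, some 0, some 1, some 0]) true
    ![some 2, some 3, none, none]) c = true := ⟨
  .split 0 T3' h
   (.swap true 0 2)
   (.envy 1 T3 g [B2]
   (.split 1 T3 B2
    (.envy 0 T3 B2 [g]
    (.cover [(0, T3, g), (2, T1', h)]))
    (.cover [(0, T2, g), (1, T3, B2), (2, T1', h)])
    (.envy 2 T1 g [B3]
    (.envy 2 T1 B3 [B2]
    (.split 2 T1 B2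
     (.loop 0 B1 [B2, g, B1])
     (.cover [(0, T2, g), (1, T1, B2)])
     (.cover [(0, T2, g), (1, T3', h), (2, T1, B2)])
     (.envy 0 T2 g [B1]
     (.split 0 T2 B1
      (.cover [(0, T2, B1), (1, T3', h), (2, T1, g)])
      (.cover [(0, T4, g), (1, T2, B1), (3, T1, B2)])
      (.loop 2 B1 [g, B3, B2, B1])
      (.loop 3 B1 [B2, B1]))))))
    (.envy 0 T2 g [B1]
    (.split 0 T2 B1
     (.cover [(0, T2, B1), (1, T3', h), (2, T1, g)])
     (.split 0 T4' h
      (.cover [(0, T4', h), (1, T2, B1), (2, T1, g), (3, T3, B2)])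
      (.swap true 1 3)
      (.envy 1 T3 g [B2]
      (.envy 1 T3 B2 [B1]
      (.split 1 T3 B1
       (.cover [(0, T3, B1), (2, T1, g)])
       (.envy 2 T1 g [B3]
       (.split 2 T1 B3
        (.envy 0 T2 g [B1]
        (.envy 0 T2 B1 [B3]
        (.split 0 T2 B3
         (.cover [(0, T2, B3), (1, T3, B1), (2, T1, g)])
         (.loop 1 B2 [B3, g, B2])
         (.cover [(1, T3, g), (2, T2, B3)])
         (.cover [(1, T3, g), (2, T4', h), (3, T2, B3)]))))
        (.loop 1 B1 [B3, B1])
        (.cover [(0, T2, g), (1, T3, B1), (2, T1, B3)])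
        (.cover [(0, T2, g), (1, T3, B1), (2, T4', h), (3, T1, B3)])))
       (.loop 2 B1 [g, B3, B1])
       (.envy 2 T1 g [B3]
       (.split 2 T1 B3
        (.cover [(0, T1, B3), (2, T4', h), (3, T3, B1)])
        (.loop 1 B1 [B3, g, B2, B1])
        (.cover [(0, T4, g), (2, T1, B3), (3, T3, B1)])
        (.loop 3 B1 [B3, B1]))))))
      (.cover [(3, T4', h)]))
     (.envy 2 T2 B1 [g]
     (.cover [(1, T3', h), (2, T2, g)]))
     (.envy 3 T3 B2 [B1]
     (.split 3 T3 B1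
      (.cover [(0, T3, B1), (2, T1, g)])
      (.envy 2 T1 g [B3]
      (.split 2 T1 B3
       (.envy 0 T2 g [B1]
       (.envy 0 T2 B1 [B3]
       (.split 0 T2 B3
        (.cover [(0, T2, B3), (1, T3, B1), (2, T1, g)])
        (.loop 1 B2 [B3, g, B2])
        (.cover [(1, T3, g), (2, T2, B3)])
        (.loop 3 B2 [B3, B2]))))
       (.loop 1 B1 [B3, B1])
       (.cover [(0, T2, g), (1, T3, B1), (2, T1, B3)])
       (.loop 3 B1 [B3, B2, B1])))
      (.loop 2 B1 [g, B3, B1])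
      (.envy 2 T1 g [B3]
      (.split 2 T1 B3
       (.envy 0 T2 g [B1]
       (.envy 0 T2 B1 [B3]
       (.split 0 T2 B3
        (.cover [(0, T2, B3), (1, T3, g), (2, T1', h)])
        (.loop 1 B2 [B3, g, B2])
        (.cover [(1, T3, g), (2, T2, B3)])
        (.loop 3 B2 [B3, B2]))))
       (.envy 1 T1 B3 [g]
       (.envy 1 T1 g [B2]
       (.split 1 T1 B2
        (.loop 0 B1 [B2, g, B1])
        (.cover [(0, T2, g), (1, T1, B2)])
        (.cover [(0, T2, g), (1, T3', h), (2, T1, B2)])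
        (.loop 3 B1 [B2, B1]))))
       (.cover [(0, T4, g), (2, T1, B3), (3, T3, B1)])
       (.loop 3 B1 [B3, B1])))))))))
   (.cover [(2, T3', h)])
   (.split 0 T4' h
    (.envy 2 T1' h [B3']
    (.split 2 T1' B3'
     (.envy 0 T4' h [B1']
     (.envy 0 T4' B1' [B3']
     (.split 0 T4' B3'
      (.cover [(0, T4', B3'), (2, T1, g), (3, T3', h)])
      (.envy 3 T3' h [B4']
      (.split 3 T3' B4'
       (.cover [(0, T3', B4'), (1, T4', B3'), (2, T1, g), (3, T2', h)])
       (.loop 1 B3' [B4', B3'])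
       (.cover [(1, T4', B3'), (2, T3', B4'), (3, T2', h)])
       (.cover [(0, T4', h), (2, T1, g), (3, T3', B4')])))
      (.cover [(2, T4', B3'), (3, T3', h)])
      (.loop 3 B3' [h, B4', B3']))))
     (.envy 3 T3' h [B4']
     (.split 3 T3' B4'
      (.envy 0 T3' B4' [h]
      (.swap true 0 2))
      (.envy 0 T4' h [B1']
      (.split 0 T4' B1'
       (.envy 1 T1' B3' [B4']
       (.split 1 T1' B4'
        (.loop 0 B1' [B4', B1'])
        (.cover [(0, T4', B1'), (1, T1', B4'), (3, T2', h)])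
        (.cover [(0, T4', B1'), (1, T3, g), (2, T1', B4'), (3, T2', h)])
        (.cover [(0, T4', B1'), (3, T1', B4')])))
       (.loop 1 B1' [B3', B4', B1'])
       (.envy 2 T4' B1' [h]
       (.swap true 2 3))
       (.envy 3 T3' h [B4']
       (.envy 3 T3' B4' [B1']
       (.split 3 T3' B1'
        (.cover [(0, T3', B1'), (2, T1', h)])
        (.cover [(0, T2, g), (1, T3', B1'), (2, T1', h)])
        (.loop 2 B1' [h, B3', B1'])
        (.cover [(0, T4, g), (2, T1', h), (3, T3', B1')]))))))
      (.envy 2 T1' h [B3']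
      (.envy 2 T1' B3' [B4']
      (.split 2 T1' B4'
       (.loop 0 B1' [B4', h, B1'])
       (.envy 0 T4' h [B1']
       (.split 0 T4' B1'
        (.cover [(0, T4', B1'), (1, T1', B4'), (3, T2', h)])
        (.loop 1 B1' [B4', B1'])
        (.loop 2 B1' [h, B3', B4', B1'])
        (.cover [(0, T2, g), (1, T1', B4'), (3, T4', B1')])))
       (.envy 0 T4' h [B1']
       (.split 0 T4' B1'
        (.cover [(0, T4', B1'), (1, T3, g), (2, T1', B4'), (3, T2', h)])
        (.cover [(0, T2, g), (1, T4', B1'), (2, T1', B4'), (3, T3', h)])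
        (.loop 2 B1' [B4', B1'])
        (.envy 3 T3' h [B4']
        (.envy 3 T3' B4' [B1']
        (.split 3 T3' B1'
         (.cover [(0, T3', B1'), (2, T1', h)])
         (.cover [(0, T2, g), (1, T3', B1'), (2, T1', h)])
         (.loop 2 B1' [h, B3', B1'])
         (.cover [(0, T4', h), (2, T1', B4'), (3, T3', B1')]))))))
       (.cover [(0, T4', h), (3, T1', B4')]))))
      (.cover [(0, T4', h), (2, T1, g), (3, T3', B4')])))
     (.cover [(0, T4, g), (2, T1', B3'), (3, T3', h)])
     (.envy 3 T1' B3' [h]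
     (.swap true 0 3))))
    (.swap true 1 3)
    (.swap true 2 3)
    (.cover [(3, T4', h)])), by decide +kernel⟩

theorem check_triangle_snd : ∃ c, check true (addChamps (addChamps [] false ![some 2, some 0, some 1, some 0]) true
    ![some 2, some 0, some 3, some 0]) c = true := ⟨
  .compare 2 g h
   (.envy 1 T3 g [B2]
   (.split 1 T3 B2
    (.envy 0 T3 B2 [g]
    (.cover [(0, T3, g), (2, T1', h)]))
    (.cover [(0, T2, g), (1, T3, B2), (2, T1', h)])
    (.envy 2 T1 g [h]
    (.split 2 T1 h
     (.cover [(0, T1, h)])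
     (.envy 0 T2 g [B1]
     (.split 0 T2 B1
      (.cover [(0, T2, B1), (1, T1, h)])
      (.envy 2 T1 g [B3]
      (.envy 2 T1 B3 [B2]
      (.split 2 T1 B2
       (.loop 0 B1 [B2, g, B1])
       (.loop 1 B1 [B2, B1])
       (.cover [(0, T4, g), (1, T2, B1), (2, T1, B2), (3, T3', h)])
       (.cover [(0, T4, g), (1, T2, B1), (3, T1, B2)]))))
      (.loop 2 B1 [g, B3, B2, B1])
      (.envy 2 T1 g [B3]
      (.envy 2 T1 B3 [B2]
      (.split 2 T1 B2
       (.loop 0 B1 [B2, g, B1])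
       (.cover [(0, T4', h), (1, T1, B2), (3, T2, B1)])
       (.cover [(0, T4', h), (1, T3, g), (2, T1, B2), (3, T2, B1)])
       (.loop 3 B1 [B2, B1]))))))
     (.envy 0 T2 g [B1]
     (.split 0 T2 B1
      (.cover [(0, T2, B1), (1, T3, g), (2, T1, h)])
      (.envy 2 T1 g [B3]
      (.envy 2 T1 B3 [B2]
      (.split 2 T1 B2
       (.loop 0 B1 [B2, g, B1])
       (.loop 1 B1 [B2, B1])
       (.cover [(0, T4, g), (1, T2, B1), (2, T1, B2), (3, T3', h)])
       (.cover [(0, T4, g), (1, T2, B1), (3, T1, B2)]))))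
      (.loop 2 B1 [g, B3, B2, B1])
      (.envy 2 T1 g [B3]
      (.envy 2 T1 B3 [B2]
      (.split 2 T1 B2
       (.loop 0 B1 [B2, g, B1])
       (.cover [(0, T4', h), (1, T1, B2), (3, T2, B1)])
       (.cover [(0, T4', h), (1, T3, g), (2, T1, B2), (3, T2, B1)])
       (.loop 3 B1 [B2, B1]))))))
     (.cover [(0, T4, g), (3, T1, h)])))
    (.envy 2 T1 g [h]
    (.split 2 T1 h
     (.cover [(0, T1, h)])
     (.envy 0 T2 g [B1]
     (.split 0 T2 B1
      (.cover [(0, T2, B1), (1, T1, h)])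
      (.cover [(0, T4', h), (1, T2, B1), (2, T1, g), (3, T3, B2)])
      (.envy 2 T1 g [B3]
      (.envy 2 T2 B1 [B3]
      (.split 2 T2 B3
       (.cover [(0, T2, B3), (1, T3, g), (2, T1', h)])
       (.loop 1 B2 [B3, g, B2])
       (.cover [(1, T3, g), (2, T2, B3)])
       (.loop 3 B2 [B3, B2]))))
      (.envy 2 T1 g [B3]
      (.split 2 T1 B3
       (.envy 0 T2 g [B1]
       (.envy 0 T2 B1 [B3]
       (.split 0 T2 B3
        (.cover [(0, T2, B3), (1, T3, g), (2, T1', h)])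
        (.loop 1 B2 [B3, g, B2])
        (.cover [(1, T3, g), (2, T2, B3)])
        (.loop 3 B2 [B3, B2]))))
       (.envy 1 T1 B3 [g]
       (.envy 1 T1 g [B2]
       (.split 1 T1 B2
        (.loop 0 B1 [B2, g, B1])
        (.cover [(0, T4', h), (1, T1, B2), (3, T2, B1)])
        (.cover [(0, T4', h), (1, T3, g), (2, T1, B2), (3, T2, B1)])
        (.loop 3 B1 [B2, B1]))))
       (.cover [(0, T4', h), (1, T3, g), (2, T1, B3), (3, T2, B1)])
       (.loop 3 B1 [B3, B2, B1])))))
     (.envy 0 T2 g [B1]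
     (.split 0 T2 B1
      (.cover [(0, T2, B1), (1, T3, g), (2, T1, h)])
      (.cover [(0, T4', h), (1, T2, B1), (2, T1, g), (3, T3, B2)])
      (.envy 2 T1 g [B3]
      (.envy 2 T2 B1 [B3]
      (.split 2 T2 B3
       (.cover [(0, T2, B3), (1, T3, g), (2, T1', h)])
       (.loop 1 B2 [B3, g, B2])
       (.cover [(1, T3, g), (2, T2, B3)])
       (.loop 3 B2 [B3, B2]))))
      (.envy 2 T1 g [B3]
      (.split 2 T1 B3
       (.envy 0 T2 g [B1]
       (.envy 0 T2 B1 [B3]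
       (.split 0 T2 B3
        (.cover [(0, T2, B3), (1, T3, g), (2, T1', h)])
        (.loop 1 B2 [B3, g, B2])
        (.cover [(1, T3, g), (2, T2, B3)])
        (.loop 3 B2 [B3, B2]))))
       (.envy 1 T1 B3 [g]
       (.envy 1 T1 g [B2]
       (.split 1 T1 B2
        (.loop 0 B1 [B2, g, B1])
        (.cover [(0, T4', h), (1, T1, B2), (3, T2, B1)])
        (.cover [(0, T4', h), (1, T3, g), (2, T1, B2), (3, T2, B1)])
        (.loop 3 B1 [B2, B1]))))
       (.cover [(0, T4', h), (1, T3, g), (2, T1, B3), (3, T2, B1)])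
       (.loop 3 B1 [B3, B2, B1])))))
     (.cover [(0, T4, g), (3, T1, h)])))))
   (.envy 2 T1' h [g]
   (.split 2 T1' g
    (.cover [(0, T1', g)])
    (.cover [(0, T2', h), (1, T1', g)])
    (.envy 0 T4' h [B1']
    (.split 0 T4' B1'
     (.cover [(0, T4', B1'), (2, T1', g), (3, T3', h)])
     (.envy 2 T1' h [B3']
     (.split 2 T1' B3'
      (.envy 0 T4' h [B1']
      (.envy 0 T4' B1' [B3']
      (.split 0 T4' B3'
       (.cover [(0, T4', B3'), (2, T1, g), (3, T3', h)])
       (.envy 3 T3' h [B4']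
       (.split 3 T3' B4'
        (.loop 0 B1' [B3', B4', h, B1'])
        (.loop 1 B3' [B4', B3'])
        (.envy 2 T1' h [B3']
        (.envy 2 T1' B3' [B4']
        (.split 2 T1' B4'
         (.loop 0 B1' [B4', h, B1'])
         (.loop 1 B1' [B4', B1'])
         (.cover [(0, T2, g), (1, T4', B3'), (2, T1', B4'), (3, T3', h)])
         (.cover [(0, T4', h), (3, T1', B4')]))))
        (.cover [(0, T2', h), (1, T4', B3'), (2, T1, g), (3, T3', B4')])))
       (.cover [(2, T4', B3'), (3, T3', h)])
       (.loop 3 B3' [h, B4', B3']))))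
      (.envy 1 T4' B1' [B3']
      (.split 1 T4' B3'
       (.cover [(0, T4', B3'), (2, T1, g), (3, T3', h)])
       (.envy 3 T3' h [B4']
       (.split 3 T3' B4'
        (.envy 0 T3' B4' [h]
        (.envy 0 T3' h [B1']
        (.split 0 T3' B1'
         (.cover [(0, T3', B1'), (2, T1', h)])
         (.loop 1 B1' [B3', B1'])
         (.loop 2 B1' [h, B3', B1'])
         (.cover [(0, T4', h), (2, T1', g), (3, T3', B1')]))))
        (.loop 1 B3' [B4', B3'])
        (.envy 2 T1' h [B3']
        (.envy 2 T1' B3' [B4']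
        (.split 2 T1' B4'
         (.loop 0 B1' [B4', h, B1'])
         (.loop 1 B1' [B4', B1'])
         (.cover [(0, T2, g), (1, T4', B3'), (2, T1', B4'), (3, T3', h)])
         (.cover [(0, T4', h), (3, T1', B4')]))))
        (.cover [(0, T2', h), (1, T4', B3'), (2, T1, g), (3, T3', B4')])))
       (.cover [(2, T4', B3'), (3, T3', h)])
       (.loop 3 B3' [h, B4', B3'])))
      (.cover [(0, T4, g), (2, T1', B3'), (3, T3', h)])
      (.envy 3 T1' B3' [h]
      (.cover [(0, T2, g), (1, T4', B1'), (3, T1', h)]))))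
     (.envy 2 T1' h [B3']
     (.envy 2 T4' B1' [B3']
     (.split 2 T4' B3'
      (.cover [(0, T4', B3'), (2, T1, g), (3, T3', h)])
      (.envy 3 T3' h [B4']
      (.split 3 T3' B4'
       (.envy 0 T3' B4' [h]
       (.envy 0 T3' h [B1']
       (.split 0 T3' B1'
        (.cover [(0, T3', B1'), (2, T1', h)])
        (.envy 2 T1' h [B3']
        (.split 2 T1' B3'
         (.loop 0 B1' [B3', B4', h, B1'])
         (.loop 1 B1' [B3', B1'])
         (.cover [(0, T4, g), (2, T1', B3'), (3, T3', h)])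
         (.envy 3 T1' B3' [h]
         (.envy 3 T1' h [B4']
         (.split 3 T1' B4'
          (.loop 0 B1' [B4', h, B1'])
          (.loop 1 B1' [B4', B3', B1'])
          (.cover [(0, T2, g), (1, T4', B3'), (2, T1', B4'), (3, T3', h)])
          (.cover [(0, T4', h), (3, T1', B4')]))))))
        (.loop 2 B1' [h, B3', B1'])
        (.cover [(0, T4', h), (2, T1', g), (3, T3', B1')]))))
       (.loop 1 B3' [B4', B3'])
       (.loop 2 B1' [h, B3', B4', B1'])
       (.cover [(0, T2', h), (1, T4', B3'), (2, T1, g), (3, T3', B4')])))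
      (.cover [(2, T4', B3'), (3, T3', h)])
      (.loop 3 B3' [h, B4', B3']))))
     (.envy 3 T3' h [B4']
     (.envy 3 T3' B4' [B1']
     (.split 3 T3' B1'
      (.cover [(0, T3', B1'), (2, T1', h)])
      (.envy 2 T1' h [B3']
      (.split 2 T1' B3'
       (.envy 0 T4' h [B1']
       (.envy 0 T4' B1' [B3']
       (.split 0 T4' B3'
        (.cover [(0, T4', B3'), (2, T1, g), (3, T3', h)])
        (.envy 3 T3' h [B4']
        (.split 3 T3' B4'
         (.loop 0 B1' [B3', B4', h, B1'])
         (.loop 1 B3' [B4', B3'])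
         (.envy 2 T1' h [B3']
         (.envy 2 T1' B3' [B4']
         (.split 2 T1' B4'
          (.loop 0 B1' [B4', h, B1'])
          (.loop 1 B1' [B4', B3', B1'])
          (.cover [(0, T2, g), (1, T4', B3'), (2, T1', B4'), (3, T3', h)])
          (.cover [(0, T4', h), (3, T1', B4')]))))
         (.cover [(0, T2', h), (1, T4', B3'), (2, T1, g), (3, T3', B4')])))
        (.cover [(2, T4', B3'), (3, T3', h)])
        (.loop 3 B3' [h, B4', B3']))))
       (.loop 1 B1' [B3', B1'])
       (.cover [(0, T4, g), (2, T1', B3'), (3, T3', h)])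
       (.loop 3 B1' [B3', h, B4', B1'])))
      (.loop 2 B1' [h, B3', B1'])
      (.cover [(0, T4', h), (2, T1', g), (3, T3', B1')]))))))
    (.cover [(0, T4', h), (3, T1', g)]))), by decide +kernel⟩

end Refutation

namespace ChampionModel

/-- The model obtained by renaming the agents and, if `b` holds, exchanging the two items. -/
def relabel (M : ChampionModel) (π : Equiv.Perm (Fin 4)) (b : Bool) : ChampionModel where
  w k l := M.w (π k) (l.1 ^^ b, l.2.map π)
  E k x s l := M.E (π k) (x ^^ b) (π s) (l.1 ^^ b, l.2.map π)
  C k x s l := M.C (π k) (x ^^ b) (π s) (l.1 ^^ b, l.2.map π)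
  mono h hw h1 h2 := M.mono h hw (by simpa [Option.map_eq_some_iff] using h1)
    (by simpa [Option.map_eq_some_iff] using h2)
  lt_of_E h1 h := M.lt_of_E (by simpa [Option.map_eq_some_iff] using h1) h
  E_self h1 h := M.E_self (by simpa [Option.map_eq_some_iff] using h1) h
  E_of_C h := M.E_of_C h
  exists_C h := by
    obtain ⟨j, hj⟩ := M.exists_C h
    exact ⟨π.symm j, by simpa using hj⟩
  C_of_E h := M.C_of_E h
  exists_E x s := by
    obtain ⟨j, hj⟩ := M.exists_E (x ^^ b) (π s)
    exact ⟨π.symm j, by simpa using hj⟩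
  no_cover D σ x l hD h hC := by
    have hinj : Function.Injective fun l : Bool × Option (Fin 4) => (l.1 ^^ b, l.2.map π) := by
      rintro ⟨y, o⟩ ⟨y', o'⟩ h
      simp only [Prod.mk.injEq] at h
      exact Prod.ext (by simpa using h.1) (Option.map_injective π.injective h.2)
    refine M.no_cover (D.map π.toEmbedding) (fun k => π (σ (π.symm k)))
      (fun i => x (π.symm i) ^^ b) (fun k => ((l (π.symm k)).1 ^^ b, (l (π.symm k)).2.map π))
      (by simpa using hD) ?_ ?_
    · simp only [Finset.mem_map, Equiv.coe_toEmbedding, forall_exists_index, and_imp,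
        forall_apply_eq_imp_iff₂, Equiv.symm_apply_apply, ne_eq, EmbeddingLike.apply_eq_iff_eq,
        exists_eq_right]
      intro k hk
      obtain ⟨h1, h2, h3⟩ := h k hk
      refine ⟨h1, fun j hj hjk => ⟨(h2 j hj hjk).1, fun he => (h2 j hj hjk).2 (hinj he)⟩, ?_⟩
      intro i hi
      obtain ⟨i', hi', rfl⟩ := Option.map_eq_some_iff.1 hi
      obtain ⟨h4, h5, h6⟩ := h3 i' hi'
      exact ⟨⟨i', h4, rfl⟩, by simpa using h5, by simp [h6]⟩
    · simp only [Finset.mem_map, Equiv.coe_toEmbedding, forall_exists_index, and_imp,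
        forall_apply_eq_imp_iff₂, Equiv.symm_apply_apply]
      exact hC

theorem relabel_C {M : ChampionModel} {π : Equiv.Perm (Fin 4)} {b x : Bool} {k s : Fin 4}
    (h : M.C (π k) (x ^^ b) (π s) (x ^^ b, none)) : (M.relabel π b).C k x s (x, none) := h

/-- A valid refutation excludes the champions that its context prescribes. -/
theorem not_of_check {M : ChampionModel} {b : Bool}
    (hb : b = true → ∀ x i j, M.C i x j (x, none) → ¬ M.C j x i (x, none))
    {P Q : Fin 4 → Option (Fin 4)}
    (hc : ∃ c, Refutation.check b (Refutation.addChamps (Refutation.addChamps [] false P) true Q)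
      c = true)
    (hP : ∀ s k, P s = some k → M.C k false s (false, none))
    (hQ : ∀ s k, Q s = some k → M.C k true s (true, none)) : False := by
  obtain ⟨c, hc⟩ := hc
  exact Refutation.not_check hb c _
    (Refutation.holds_addChamps (M := M) (Refutation.holds_addChamps (by simp) hP) hQ) hc

theorem exists_perm_of_swap : ∀ g : Fin 4 → Fin 4, (∀ s, g s ≠ s) → (∃ i, g (g i) = i) →
    ∃ P ∈ [![1, 0, 0, 0], ![1, 0, 0, 1], ![1, 0, 0, 2], ![1, 0, 3, 2]],
      ∃ π : Equiv.Perm (Fin 4), ∀ s, g (π s) = π (P s) := by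
  decide +kernel

theorem exists_perm_of_not_swap : ∀ g : Fin 4 → Fin 4, (∀ s, g s ≠ s) → (∀ i, g (g i) ≠ i) →
    ∃ P ∈ [![3, 0, 1, 2], ![2, 0, 1, 0]],
      ∃ π : Equiv.Perm (Fin 4), ∀ s, g (π s) = π (P s) := by
  decide +kernel

theorem four_cycle_cases : ∀ h : Fin 4 → Fin 4, (∀ s, h s ≠ s) → (∀ i, h (h i) ≠ i) →
    (∀ i, h ((![3, 0, 1, 2] : Fin 4 → Fin 4) i) ≠ i) →
    ∃ n : Fin 4, ∃ Q ∈ [![some 3, some 0, some 1, some 2], ![some 2, none, some 1, some 2]],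
      ∀ s k : Fin 4, Q s = some k → h (s + n) = k + n := by
  decide +kernel

theorem triangle_cases : ∀ h : Fin 4 → Fin 4, (∀ s, h s ≠ s) → (∀ i, h (h i) ≠ i) →
    (∀ i, h ((![2, 0, 1, 0] : Fin 4 → Fin 4) i) ≠ i) →
    (∃ π : Equiv.Perm (Fin 4), ∀ s, h (π s) = π (![3, 0, 1, 2] s)) ∨
      ∃ Q ∈ [![some 2, some 0, some 1, none], ![some 2, some 3, none, none],
        ![some 2, some 0, some 3, some 0]], ∀ s k : Fin 4, Q s = some k → h s = k := by
  decide +kernel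

variable {M : ChampionModel}

theorem exists_champion (M : ChampionModel) : ∃ c : Bool → Fin 4 → Fin 4,
    ∀ x s, M.C (c x s) x s (x, none) := by
  have h : ∀ x s, ∃ k, M.C k x s (x, none) := fun x s =>
    (M.exists_E x s).imp fun k hk => M.C_of_E hk
  choose c hc using h
  exact ⟨c, hc⟩

theorem relabel_champion {c : Bool → Fin 4 → Fin 4} (hc : ∀ x s, M.C (c x s) x s (x, none))
    (π : Equiv.Perm (Fin 4)) (b x : Bool) (s k : Fin 4) (h : c (x ^^ b) (π s) = π k) :
    (M.relabel π b).C k x s (x, none) := relabel_C (h ▸ hc _ _)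

theorem champion_ne {c : Bool → Fin 4 → Fin 4} (hc : ∀ x s, M.C (c x s) x s (x, none))
    (x : Bool) (s : Fin 4) : c x s ≠ s := fun h => M.not_C_item s x (by simpa [h] using hc x s)

theorem not_C_swap_of_perm {P : Fin 4 → Fin 4} (hP : ∀ s, M.C (P s) false s (false, none))
    (h : P ∈ [![1, 0, 0, 0], ![1, 0, 0, 1], ![1, 0, 0, 2], ![1, 0, 3, 2]]) : False := by
  obtain ⟨Q, hQ, hc⟩ : ∃ Q : Fin 4 → Option (Fin 4), (∀ s, Q s = some (P s)) ∧
      ∃ c, Refutation.check false (Refutation.addChamps [] false Q) c = true := by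
    simp only [List.mem_cons, List.not_mem_nil, or_false] at h
    rcases h with rfl | rfl | rfl | rfl
    · exact ⟨_, by decide, Refutation.check_swap_star⟩
    · exact ⟨_, by decide, Refutation.check_swap_two_swap⟩
    · exact ⟨_, by decide, Refutation.check_swap_path⟩
    · exact ⟨_, by decide, Refutation.check_two_swaps⟩
  obtain ⟨c, hc⟩ := hc
  refine Refutation.not_check (M := M) (by simp) c _ (Refutation.holds_addChamps (by simp) ?_) hc
  intro s k hk
  rw [hQ, Option.some.injEq] at hk
  exact hk ▸ hP s

/-- Two agents are never champions of each other for the same item. -/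
theorem not_C_swap (M : ChampionModel) (x : Bool) (i j : Fin 4) (h : M.C i x j (x, none)) :
    ¬ M.C j x i (x, none) := by
  intro h'
  have hij : i ≠ j := by
    rintro rfl
    exact M.not_C_item _ _ h
  obtain ⟨c, hc⟩ := M.exists_champion
  have hg : ∀ s, M.C (Function.update (Function.update (c x) j i) i j s) x s (x, none) := by
    intro s
    by_cases hi : s = i
    · subst hi
      simpa using h'
    · by_cases hj : s = j
      · subst hj
        simpa [hi] using h
      · simpa [hi, hj] using hc x s
  obtain ⟨P, hP, π, hπ⟩ := exists_perm_of_swap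
    (Function.update (Function.update (c x) j i) i j)
    (fun s hs => M.not_C_item s x (by simpa [hs] using hg s)) ⟨i, by simp [hij.symm]⟩
  refine not_C_swap_of_perm (M := M.relabel π x) (P := P) (fun s => relabel_C ?_) hP
  rw [← hπ, Bool.false_xor]
  exact hg _

theorem champion_champion_ne {c : Bool → Fin 4 → Fin 4}
    (hc : ∀ x s, M.C (c x s) x s (x, none)) (x y : Bool) (i : Fin 4) : c y (c x i) ≠ i := by
  intro h
  by_cases hxy : x = y
  · subst hxy
    exact M.not_C_swap x _ _ (hc x i) (by simpa [h] using hc x (c x i))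
  · have hi := champion_ne hc x i
    refine M.no_cover {i, c x i} (fun k => if k = i then c x i else i)
      (fun k => if k = i then x else y) (fun k => if k = i then (y, none) else (x, none))
      ⟨i, by simp⟩ ?_ ?_
    · simp [hi, hi.symm, hxy, Ne.symm hxy]
    · simpa [hi, hi.symm, h] using ⟨by simpa [h] using hc y (c x i), hc x i⟩

theorem not_four_cycle {c : Bool → Fin 4 → Fin 4} (hc : ∀ x s, M.C (c x s) x s (x, none))
    (h : ∀ s, c false s = (![3, 0, 1, 2] : Fin 4 → Fin 4) s) : False := by
  obtain ⟨n, Q, hQ, hQ'⟩ := four_cycle_cases (c true) (champion_ne hc true)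
    (champion_champion_ne hc true true) (fun i => h i ▸ champion_champion_ne hc false true i)
  refine not_of_check (M := M.relabel (Equiv.addRight n) false) (b := true)
    (fun _ => not_C_swap _) (P := ![some 3, some 0, some 1, some 2]) (Q := Q) ?_ ?_ ?_
  · simp only [List.mem_cons, List.not_mem_nil, or_false] at hQ
    rcases hQ with rfl | rfl
    · exact Refutation.check_equal_cycles
    · exact Refutation.check_cycle
  · intro s k hk
    refine relabel_champion hc _ false false s k ?_
    rw [Bool.false_xor, h]
    clear hQ'
    revert s k n
    decide
  · intro s k hk
    exact relabel_champion hc _ false true s k (hQ' s k hk)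

theorem not_triangle {c : Bool → Fin 4 → Fin 4} (hc : ∀ x s, M.C (c x s) x s (x, none))
    (h : ∀ s, c false s = (![2, 0, 1, 0] : Fin 4 → Fin 4) s) : False := by
  rcases triangle_cases (c true) (champion_ne hc true) (champion_champion_ne hc true true)
    (fun i => h i ▸ champion_champion_ne hc false true i) with ⟨π, hπ⟩ | ⟨Q, hQ, hQ'⟩
  · exact not_four_cycle (M := M.relabel π true)
      (c := fun x s => π.symm (c (x ^^ true) (π s)))
      (fun x s => relabel_champion hc π true x s _ (by simp)) (fun s => by simp [hπ])
  · refine not_of_check (M := M) (b := true) (fun _ => not_C_swap _)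
      (P := ![some 2, some 0, some 1, some 0]) (Q := Q) ?_ ?_ ?_
    · simp only [List.mem_cons, List.not_mem_nil, or_false] at hQ
      rcases hQ with rfl | rfl | rfl
      · exact Refutation.check_equal_triangles
      · exact Refutation.check_triangle_fst
      · exact Refutation.check_triangle_snd
    · intro s k hk
      have : c false s = k := by
        rw [h]
        revert s k
        decide
      exact this ▸ hc false s
    · intro s k hk
      exact hQ' s k hk ▸ hc true s

/-- There is no champion model. -/
protected theorem false (M : ChampionModel) : False := by
  obtain ⟨c, hc⟩ := M.exists_champion
  obtain ⟨P, hP, π, hπ⟩ := exists_perm_of_not_swap (c false) (champion_ne hc false)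
    (champion_champion_ne hc false false)
  have hc' : ∀ x s, (M.relabel π false).C (π.symm (c x (π s))) x s (x, none) := fun x s =>
    relabel_champion hc π false x s _ (by simp)
  simp only [List.mem_cons, List.not_mem_nil, or_false] at hP
  rcases hP with rfl | rfl
  · exact not_four_cycle (c := fun x s => π.symm (c x (π s))) hc' fun s => by simp [hπ]
  · exact not_triangle (c := fun x s => π.symm (c x (π s))) hc' fun s => by simp [hπ]

end ChampionModel

namespace Setting

variable {ι : Type*} [DecidableEq ι] {v : Fin 4 → Finset ι → ℝ} {a : Fin 4 → Fin 4}
  {X : Fin 4 → Finset ι}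

/-- The goods that the label `l` of a champion model stands for. -/
def goods (X : Fin 4 → Finset ι) (x : Bool → ι) (T : Bool → Fin 4 → Finset ι) :
    Bool × Option (Fin 4) → Finset ι
  | (y, none) => {x y}
  | (y, some i) => X i \ T y i

theorem disjoint_goods {x : Bool → ι} {T : Bool → Fin 4 → Finset ι}
    (hx : ∀ y i, x y ∉ X i) (hT : ∀ y i, T y i ⊆ X i) (S : Setting v a X) {y : Bool} {s : Fin 4}
    {l : Bool × Option (Fin 4)} (hl : ∀ i, l.2 = some i → i = s → l.1 = y) :
    Disjoint (T y s) (goods X x T l) := by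
  rw [Finset.disjoint_left]
  intro e he h
  obtain ⟨z, _ | i⟩ := l
  · simp only [goods, Finset.mem_singleton] at h
    exact hx z s (h ▸ hT y s he)
  · simp only [goods, Finset.mem_sdiff] at h
    have : s = i := S.eq_of_mem (hT y s he) h.1
    subst this
    have := hl s rfl rfl
    dsimp only at this
    subst this
    exact h.2 he

theorem disjoint_goods_goods {x : Bool → ι} {T : Bool → Fin 4 → Finset ι}
    (hinj : x false ≠ x true) (hx : ∀ y i, x y ∉ X i) (S : Setting v a X)
    {l l' : Bool × Option (Fin 4)} (hne : l ≠ l')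
    (hl : ∀ i, l.2 = some i → l'.2 = some i → l.1 = l'.1) :
    Disjoint (goods X x T l) (goods X x T l') := by
  rw [Finset.disjoint_left]
  intro e h h'
  obtain ⟨z, _ | i⟩ := l <;> obtain ⟨z', _ | i'⟩ := l' <;>
    simp only [goods, Finset.mem_singleton, Finset.mem_sdiff] at h h'
  · subst h
    cases z <;> cases z' <;> simp_all
  · exact hx z i' (h ▸ h'.1)
  · exact hx z' i (h' ▸ h.1)
  · have := S.eq_of_mem h.1 h'.1
    subst this
    have := hl i rfl rfl
    dsimp only at this
    exact hne (by rw [this])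

/-- The champion model of an envy-free allocation that cannot be improved. -/
def championModel (S : Setting v a X) (hn : ¬ Improvable v a X)
    (hfree : ∀ i j, ¬ EnviesSet v X i (X j)) (x : Bool → ι) (hinj : x false ≠ x true)
    (hx : ∀ y i, x y ∉ X i) (T : Bool → Fin 4 → Finset ι) (hT : ∀ y i, T y i ⊆ X i)
    (hsafe : ∀ y i, Safe v (fun i => v i (X i)) (insert (x y) (T y i)))
    (henv : ∀ y i, ∃ c, EnviesSet v X c (insert (x y) (T y i))) : ChampionModel where
  w k l := v k (goods X x T l)
  E k y s l := EnviesSet v X k (goods X x T l ∪ T y s) ∧ l.2 ≠ some s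
  C k y s l := ∃ Z ⊆ goods X x T l ∪ T y s, l.2 ≠ some s ∧
    Safe v (fun i => v i (X i)) Z ∧ EnviesSet v X k Z
  mono {k y s l l'} h hw h1 h2 :=
    ⟨h.1.trans_le ((S.canc k).union_le (disjoint_goods hx hT S (by grind)).symm
      (disjoint_goods hx hT S (by grind)).symm hw), h2⟩
  lt_of_E {k y s l} h1 h := by
    refine (S.canc k).lt_of_union_lt (R := T y s) (disjoint_goods hx hT S (by simp)).symm
      (disjoint_goods hx hT S (by grind)).symm (lt_of_le_of_lt ?_ h.1)
    rw [goods, Finset.sdiff_union_of_subset (hT y s)]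
    exact not_lt.1 (hfree k s)
  E_self {k y l} h1 h := by
    refine ⟨?_, h1⟩
    have := (S.canc k).union_lt (S.nd k) (R := T y k) (disjoint_goods hx hT S (by simp)).symm
      (disjoint_goods hx hT S (by grind)).symm h
    rwa [goods, Finset.sdiff_union_of_subset (hT y k)] at this
  E_of_C {k y s l} h := by
    obtain ⟨Z, hZ, h1, -, h2⟩ := h
    exact ⟨h2.trans_le (S.mono k hZ), h1⟩
  exists_C {k y s l} h := by
    obtain ⟨Z, hZ, h1, c, h2⟩ := exists_safe_envied (fun i => v i (X i)) _ k h.1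
    exact ⟨c, Z, hZ, h.2, h1, h2⟩
  C_of_E {k y s} h := ⟨_, subset_rfl, by simp, hsafe y s, h.1⟩
  exists_E y s := (henv y s).imp fun c hc => ⟨hc, by simp⟩
  no_cover D σ y l hD h hC := by
    choose! Z hZ hl hs hE using hC
    have hmem : ∀ k ∈ D, ∀ e ∈ Z k, e ∈ goods X x T (l k) ∨ e ∈ T (y (σ k)) (σ k) :=
      fun k hk e he => Finset.mem_union.1 (hZ k hk he)
    have hTX : ∀ k ∈ D, ∀ j ∈ D, j ≠ k →
        Disjoint (T (y (σ k)) (σ k)) (goods X x T (l j)) := fun k hk j hj hjk =>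
      disjoint_goods hx hT S fun i hi h' => h' ▸ ((h j hj).2.2 i hi).2.2
    refine hn (S.improvable_of_cover hD hs hE ?_ ?_)
    · intro k hk j hj hkj
      rw [Finset.disjoint_left]
      intro e he he'
      rcases hmem k hk e he with h1 | h1 <;> rcases hmem j hj e he' with h2 | h2
      · refine Finset.disjoint_left.1 (disjoint_goods_goods hinj hx S ?_ ?_) h1 h2
        · exact ((h j hj).2.1 k hk hkj).2
        · intro i hi hi'
          rw [((h k hk).2.2 i hi).2.2, ((h j hj).2.2 i hi').2.2]
      · exact Finset.disjoint_left.1 (hTX j hj k hk hkj) h2 h1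
      · exact Finset.disjoint_left.1 (hTX k hk j hj hkj.symm) h1 h2
      · exact ((h j hj).2.1 k hk hkj).1 (S.eq_of_mem (hT _ _ h1) (hT _ _ h2))
    · intro k hk j hj
      rw [Finset.disjoint_left]
      intro e he he'
      rcases hmem k hk e he with h1 | h1
      · have hi := (h k hk).2.2
        generalize l k = lk at h1 hi
        obtain ⟨z, _ | i⟩ := lk
        · simp only [goods, Finset.mem_singleton] at h1
          exact hx z j (h1 ▸ he')
        · simp only [goods, Finset.mem_sdiff] at h1
          exact hj (S.eq_of_mem h1.1 he' ▸ (hi i rfl).1)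
      · exact hj (S.eq_of_mem (hT _ _ h1) he' ▸ (h k hk).1)

/-- An envy-free allocation that leaves out two items is improvable. -/
theorem improvable_of_envyFree (S : Setting v a X) (hfree : ∀ i j, ¬ EnviesSet v X i (X j))
    {g h : ι} (hgh : g ≠ h) (hg : ∀ i, g ∉ X i) (hh : ∀ i, h ∉ X i) : Improvable v a X := by
  by_contra hn
  have hx : ∀ y i, (cond y h g) ∉ X i := fun y => by cases y <;> assumption
  have key := fun y s => S.exists_champion_set (s := s) (fun k => hfree k s) (hx y s)
  choose T hT hsafe henv using key
  exact (S.championModel hn hfree (fun y => cond y h g) hgh hx T hT hsafe henv).false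

end Setting

/-- The value of `S` to agent `i` is at least `θ i`, and `S` is safe at the levels `θ`. -/
def Fits {ι : Type*} [DecidableEq ι] (v : Fin 4 → Finset ι → ℝ) (θ : Fin 4 → ℝ) (i : Fin 4)
    (S : Finset ι) : Prop :=
  Safe v θ S ∧ θ i ≤ v i S

/-- No item belongs to two of the four bundles. -/
def PairwiseApart {ι : Type*} (A B C D : Finset ι) : Prop :=
  ∀ e, (e ∈ A → e ∉ B ∧ e ∉ C ∧ e ∉ D) ∧ (e ∈ B → e ∉ C ∧ e ∉ D) ∧ (e ∈ C → e ∉ D)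

theorem PairwiseApart.isPartialAlloc {ι : Type*} {A B C D : Finset ι}
    (h : PairwiseApart A B C D) : IsPartialAlloc ![A, B, C, D] := by
  intro i j hij
  rw [Finset.disjoint_left]
  intro e
  have := h e
  fin_cases i <;> fin_cases j <;> simp at hij ⊢ <;> tauto

/-- Agent `3` is envied by agent `0`, the other agents are unenvied, and the allocation cannot be
improved; `T s` and `T' s` are what the champion sets of `s` for the unallocated items `g` and `h`
keep of `X s`. -/
structure OneEnvied {ι : Type*} [DecidableEq ι] (v : Fin 4 → Finset ι → ℝ) (a : Fin 4 → Fin 4)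
    (X : Fin 4 → Finset ι) (g h : ι) (T T' : Fin 4 → Finset ι) : Prop extends Setting v a X where
  not_improvable : ¬ Improvable v a X
  ne : g ≠ h
  notMem_fst : ∀ i, g ∉ X i
  notMem_snd : ∀ i, h ∉ X i
  subset_fst : ∀ i, T i ⊆ X i
  subset_snd : ∀ i, T' i ⊆ X i
  safe_fst : ∀ i, i ≠ 3 → Safe v (fun i => v i (X i)) (insert g (T i))
  safe_snd : ∀ i, i ≠ 3 → Safe v (fun i => v i (X i)) (insert h (T' i))
  exists_fst : ∀ i, i ≠ 3 → ∃ k, EnviesSet v X k (insert g (T i))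
  exists_snd : ∀ i, i ≠ 3 → ∃ k, EnviesSet v X k (insert h (T' i))
  source : ∀ i, i ≠ 3 → ∀ k, ¬ EnviesSet v X k (X i)
  envied : EnviesSet v X 0 (X 3)

theorem Setting.improvable_of_fits {ι : Type*} [DecidableEq ι] {v : Fin 4 → Finset ι → ℝ}
    {a : Fin 4 → Fin 4} {X : Fin 4 → Finset ι} {θ : Fin 4 → ℝ} {A B C D : Finset ι}
    (hA : Fits v θ 0 A) (hB : Fits v θ 1 B) (hC : Fits v θ 2 C) (hD : Fits v θ 3 D)
    (hd : PairwiseApart A B C D) (hdom : Dominates v a ![A, B, C, D] X) : Improvable v a X := by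
  refine ⟨_, hd.isPartialAlloc, isEFX_of_safe (θ := θ) ?_ ?_, hdom⟩
  · intro i
    fin_cases i
    exacts [hA.1, hB.1, hC.1, hD.1]
  · intro i
    fin_cases i
    exacts [hA.2, hB.2, hC.2, hD.2]

namespace OneEnvied

variable {ι : Type*} [DecidableEq ι] {v : Fin 4 → Finset ι → ℝ} {a : Fin 4 → Fin 4}
  {X : Fin 4 → Finset ι} {g h : ι} {T T' : Fin 4 → Finset ι}

theorem symm (O : OneEnvied v a X g h T T') : OneEnvied v a X h g T' T :=
  { O with
    ne := O.ne.symm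
    notMem_fst := O.notMem_snd
    notMem_snd := O.notMem_fst
    subset_fst := O.subset_snd
    subset_snd := O.subset_fst
    safe_fst := O.safe_snd
    safe_snd := O.safe_fst
    exists_fst := O.exists_snd
    exists_snd := O.exists_fst }

theorem swap (O : OneEnvied v a X g h T T') : OneEnvied (fun i => v (Equiv.swap 1 2 i))
    (fun i => (Equiv.swap 1 2 : Equiv.Perm (Fin 4)).symm (a i)) (fun i => X (Equiv.swap 1 2 i))
    g h (fun i => T (Equiv.swap 1 2 i)) (fun i => T' (Equiv.swap 1 2 i)) where
  toSetting := O.toSetting.perm (Equiv.swap 1 2)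
  not_improvable h := O.not_improvable h.perm
  ne := O.ne
  notMem_fst i := O.notMem_fst _
  notMem_snd i := O.notMem_snd _
  subset_fst i := O.subset_fst _
  subset_snd i := O.subset_snd _
  safe_fst i hi j := O.safe_fst (Equiv.swap 1 2 i) (by decide +revert) (Equiv.swap 1 2 j)
  safe_snd i hi j := O.safe_snd (Equiv.swap 1 2 i) (by decide +revert) (Equiv.swap 1 2 j)
  exists_fst i hi := by
    obtain ⟨k, hk⟩ := O.exists_fst (Equiv.swap 1 2 i) (by decide +revert)
    exact ⟨Equiv.swap 1 2 k, by simpa [EnviesSet] using hk⟩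
  exists_snd i hi := by
    obtain ⟨k, hk⟩ := O.exists_snd (Equiv.swap 1 2 i) (by decide +revert)
    exact ⟨Equiv.swap 1 2 k, by simpa [EnviesSet] using hk⟩
  source i hi k := O.source (Equiv.swap 1 2 i) (by decide +revert) (Equiv.swap 1 2 k)
  envied := O.envied

theorem fits_own (O : OneEnvied v a X g h T T') (i : Fin 4) :
    Fits v (fun i => v i (X i)) i (X i) := ⟨O.safe_own i, le_rfl⟩

theorem fits_fst (O : OneEnvied v a X g h T T') {i k : Fin 4} (hk : EnviesSet v X k (insert g (T i)))
    (hi : i ≠ 3 := by decide) : Fits v (fun i => v i (X i)) k (insert g (T i)) :=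
  ⟨O.safe_fst i hi, hk.le⟩

theorem fits_snd (O : OneEnvied v a X g h T T') {i k : Fin 4}
    (hk : EnviesSet v X k (insert h (T' i))) (hi : i ≠ 3 := by decide) :
    Fits v (fun i => v i (X i)) k (insert h (T' i)) := O.symm.fits_fst hk hi

theorem fits_envied (O : OneEnvied v a X g h T T') {k : Fin 4} (hk : EnviesSet v X k (X 3)) :
    Fits v (fun i => v i (X i)) k (X 3) := ⟨O.safe_own 3, hk.le⟩

theorem not_pareto (O : OneEnvied v a X g h T T') {A B C D : Finset ι} (k : Fin 4)
    (hk : EnviesSet v X k (![A, B, C, D] k)) (hA : Fits v (fun i => v i (X i)) 0 A)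
    (hB : Fits v (fun i => v i (X i)) 1 B) (hC : Fits v (fun i => v i (X i)) 2 C)
    (hD : Fits v (fun i => v i (X i)) 3 D) (hd : PairwiseApart A B C D) : False := by
  obtain ⟨k, rfl⟩ := O.bij.2 k
  refine O.not_improvable
    (Setting.improvable_of_fits hA hB hC hD hd (dominates_of_le k (fun j _ => ?_) hk))
  generalize a j = i
  fin_cases i
  exacts [hA.2, hB.2, hC.2, hD.2]

/-- The facts that decide whether bundles made of the sets at hand overlap. -/
theorem apart (O : OneEnvied v a X g h T T') :
    (∀ e i j, e ∈ X i → e ∈ X j → i = j) ∧ g ≠ h ∧ (∀ i, g ∉ X i) ∧ (∀ i, h ∉ X i) ∧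
      (∀ i, T i ⊆ X i) ∧ ∀ i, T' i ⊆ X i :=
  ⟨fun _ _ _ => O.eq_of_mem, O.ne, O.notMem_fst, O.notMem_snd, O.subset_fst, O.subset_snd⟩

theorem not_envies_self (O : OneEnvied v a X g h T T') {i : Fin 4} (hi : i ≠ 3) :
    ¬ EnviesSet v X i (insert g (T i)) := by
  intro hk
  obtain ⟨hX, hgh, hg, hh, hT, hT'⟩ := O.apart
  have key : ∀ i : Fin 4, i ≠ 3 → i = 0 ∨ i = 1 ∨ i = 2 := by decide
  rcases key i hi with rfl | rfl | rfl
  · exact O.not_pareto 0 hk (O.fits_fst hk) (O.fits_own 1) (O.fits_own 2) (O.fits_own 3)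
      (by intro e; grind)
  · exact O.not_pareto 1 hk (O.fits_own 0) (O.fits_fst hk) (O.fits_own 2) (O.fits_own 3)
      (by intro e; grind)
  · exact O.not_pareto 2 hk (O.fits_own 0) (O.fits_own 1) (O.fits_fst hk) (O.fits_own 3)
      (by intro e; grind)

theorem not_envies_three_zero (O : OneEnvied v a X g h T T') :
    ¬ EnviesSet v X 3 (insert g (T 0)) := by
  intro hk
  obtain ⟨hX, hgh, hg, hh, hT, hT'⟩ := O.apart
  exact O.not_pareto 3 hk (O.fits_envied O.envied) (O.fits_own 1) (O.fits_own 2) (O.fits_fst hk)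
    (by intro e; grind)

theorem not_envies_swap_one (O : OneEnvied v a X g h T T')
    (hk : EnviesSet v X 1 (insert g (T 0))) :
    ¬ EnviesSet v X 0 (insert h (T' 1)) ∧ ¬ EnviesSet v X 3 (insert h (T' 1)) := by
  obtain ⟨hX, hgh, hg, hh, hT, hT'⟩ := O.apart
  constructor <;> intro hk'
  · exact O.not_pareto 1 hk (O.fits_snd hk') (O.fits_fst hk) (O.fits_own 2) (O.fits_own 3)
      (by intro e; grind)
  · exact O.not_pareto 1 hk (O.fits_envied O.envied) (O.fits_fst hk) (O.fits_own 2)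
      (O.fits_snd hk') (by intro e; grind)

theorem not_envies_swap_two (O : OneEnvied v a X g h T T')
    (hk : EnviesSet v X 2 (insert g (T 0))) :
    ¬ EnviesSet v X 0 (insert h (T' 2)) ∧ ¬ EnviesSet v X 3 (insert h (T' 2)) := by
  obtain ⟨hX, hgh, hg, hh, hT, hT'⟩ := O.apart
  constructor <;> intro hk'
  · exact O.not_pareto 2 hk (O.fits_snd hk') (O.fits_own 1) (O.fits_fst hk) (O.fits_own 3)
      (by intro e; grind)
  · exact O.not_pareto 2 hk (O.fits_envied O.envied) (O.fits_own 1) (O.fits_fst hk)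
      (O.fits_snd hk') (by intro e; grind)

theorem not_envies_one_two (O : OneEnvied v a X g h T T')
    (hk : EnviesSet v X 2 (insert g (T 1))) : ¬ EnviesSet v X 1 (insert h (T' 2)) := by
  obtain ⟨hX, hgh, hg, hh, hT, hT'⟩ := O.apart
  intro hk'
  exact O.not_pareto 2 hk (O.fits_own 0) (O.fits_snd hk') (O.fits_fst hk) (O.fits_own 3)
    (by intro e; grind)

end OneEnvied

/-- The enviers of the champion sets are arranged along the cycle `0 ← 2 ← 1 ← 0`, except that
agent `3` may stand in for `0`. -/
structure Cyclic {ι : Type*} [DecidableEq ι] (v : Fin 4 → Finset ι → ℝ) (a : Fin 4 → Fin 4)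
    (X : Fin 4 → Finset ι) (g h : ι) (T T' : Fin 4 → Finset ι) : Prop
    extends OneEnvied v a X g h T T' where
  envies_zero : ∀ k, EnviesSet v X k (insert g (T 0)) ↔ k = 2
  envies_zero' : ∀ k, EnviesSet v X k (insert h (T' 0)) ↔ k = 2
  envies_two : ∀ k, EnviesSet v X k (insert g (T 2)) ↔ k = 1
  envies_two' : ∀ k, EnviesSet v X k (insert h (T' 2)) ↔ k = 1
  envies_one : ∀ k, EnviesSet v X k (insert g (T 1)) → k = 0 ∨ k = 3
  envies_one' : ∀ k, EnviesSet v X k (insert h (T' 1)) → k = 0 ∨ k = 3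

theorem OneEnvied.cyclic_or {ι : Type*} [DecidableEq ι] {v : Fin 4 → Finset ι → ℝ}
    {a : Fin 4 → Fin 4} {X : Fin 4 → Finset ι} {g h : ι} {T T' : Fin 4 → Finset ι}
    (O : OneEnvied v a X g h T T') : Cyclic v a X g h T T' ∨
      Cyclic (fun i => v (Equiv.swap 1 2 i))
        (fun i => (Equiv.swap 1 2 : Equiv.Perm (Fin 4)).symm (a i)) (fun i => X (Equiv.swap 1 2 i))
        g h (fun i => T (Equiv.swap 1 2 i)) (fun i => T' (Equiv.swap 1 2 i)) := by
  have g0 := O.exists_fst 0 (by decide)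
  have g1 := O.exists_fst 1 (by decide)
  have g2 := O.exists_fst 2 (by decide)
  have h0 := O.exists_snd 0 (by decide)
  have h1 := O.exists_snd 1 (by decide)
  have h2 := O.exists_snd 2 (by decide)
  have sg0 := O.not_envies_self (i := 0) (by decide)
  have sg1 := O.not_envies_self (i := 1) (by decide)
  have sg2 := O.not_envies_self (i := 2) (by decide)
  have sh0 := O.symm.not_envies_self (i := 0) (by decide)
  have sh1 := O.symm.not_envies_self (i := 1) (by decide)
  have sh2 := O.symm.not_envies_self (i := 2) (by decide)
  have g3 := O.not_envies_three_zero
  have h3 := O.symm.not_envies_three_zero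
  have a1 := O.not_envies_swap_one
  have a2 := O.not_envies_swap_two
  have a3 := O.not_envies_one_two
  have b1 := O.symm.not_envies_swap_one
  have b2 := O.symm.not_envies_swap_two
  have b3 := O.symm.not_envies_one_two
  have s1 : (Equiv.swap 1 2 : Equiv.Perm (Fin 4)) 0 = 0 := by decide
  have s2 : (Equiv.swap 1 2 : Equiv.Perm (Fin 4)) 1 = 2 := by decide
  have s3 : (Equiv.swap 1 2 : Equiv.Perm (Fin 4)) 2 = 1 := by decide
  have s4 : (Equiv.swap 1 2 : Equiv.Perm (Fin 4)) 3 = 3 := by decide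
  have hsplit :
      (EnviesSet v X 2 (insert g (T 0)) ∧ EnviesSet v X 2 (insert h (T' 0)) ∧
        ¬ EnviesSet v X 1 (insert g (T 0)) ∧ ¬ EnviesSet v X 1 (insert h (T' 0)) ∧
        ¬ EnviesSet v X 2 (insert g (T 1)) ∧ ¬ EnviesSet v X 2 (insert h (T' 1)) ∧
        (EnviesSet v X 1 (insert g (T 2)) ∧ EnviesSet v X 1 (insert h (T' 2))) ∧
        ¬ EnviesSet v X 0 (insert g (T 2)) ∧ ¬ EnviesSet v X 0 (insert h (T' 2)) ∧
        ¬ EnviesSet v X 3 (insert g (T 2)) ∧ ¬ EnviesSet v X 3 (insert h (T' 2))) ∨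
      (EnviesSet v X 1 (insert g (T 0)) ∧ EnviesSet v X 1 (insert h (T' 0)) ∧
        ¬ EnviesSet v X 2 (insert g (T 0)) ∧ ¬ EnviesSet v X 2 (insert h (T' 0)) ∧
        ¬ EnviesSet v X 1 (insert g (T 2)) ∧ ¬ EnviesSet v X 1 (insert h (T' 2)) ∧
        (EnviesSet v X 2 (insert g (T 1)) ∧ EnviesSet v X 2 (insert h (T' 1))) ∧
        ¬ EnviesSet v X 0 (insert g (T 1)) ∧ ¬ EnviesSet v X 0 (insert h (T' 1)) ∧
        ¬ EnviesSet v X 3 (insert g (T 1)) ∧ ¬ EnviesSet v X 3 (insert h (T' 1))) := by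
    simp only [Fin.exists_fin_succ, Fin.succ_zero_eq_one, Fin.succ_one_eq_two, Fin.isValue,
      IsEmpty.exists_iff, or_false] at g0 g1 g2 h0 h1 h2
    have t : (Fin.succ 2 : Fin 4) = 3 := rfl
    rw [t] at g0 g1 g2 h0 h1 h2
    grind (splits := 40)
  have key : ∀ {P : Fin 4 → Prop}, P 0 ∧ P 1 ∧ P 2 ∧ P 3 → ∀ i, P i := by
    intro P hP
    simpa [Fin.forall_fin_succ] using hP
  clear a1 a2 a3 b1 b2 b3 g0 g1 g2 h0 h1 h2
  rcases hsplit with hs | hs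
  · refine Or.inl ⟨O, ?_, ?_, ?_, ?_, ?_, ?_⟩ <;> refine key ?_ <;>
      simp [hs, sg0, sg1, sg2, sh0, sh1, sh2, g3, h3]
  · simp only [EnviesSet] at hs sg0 sg1 sg2 sh0 sh1 sh2 g3 h3
    refine Or.inr ⟨O.swap, ?_, ?_, ?_, ?_, ?_, ?_⟩ <;> refine key ?_ <;>
      simp only [EnviesSet, s1, s2, s3, s4] <;>
      simp [hs, sg0, sg1, sg2, sh0, sh1, sh2, g3, h3]

namespace OneEnvied

variable {ι : Type*} [DecidableEq ι] {v : Fin 4 → Finset ι → ℝ} {a : Fin 4 → Fin 4}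
  {X : Fin 4 → Finset ι} {g h : ι} {T T' : Fin 4 → Finset ι}

theorem disjoint_singleton_fst (O : OneEnvied v a X g h T T') (t : Fin 4) :
    Disjoint {g} (T t) :=
  Finset.disjoint_singleton_left.2 fun hg => O.notMem_fst t (O.subset_fst t hg)

theorem disjoint_sdiff_fst (O : OneEnvied v a X g h T T') (s t : Fin 4) :
    Disjoint (X s \ T s) (T t) := by
  rw [Finset.disjoint_left]
  intro e he het
  rw [Finset.mem_sdiff] at he
  exact he.2 (O.eq_of_mem he.1 (O.subset_fst t het) ▸ het)

/-- An agent whose set `T k` is not worth keeping with the item prefers what is discarded. -/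
theorem envies_union_sdiff (O : OneEnvied v a X g h T T') {k t : Fin 4}
    (hk : ¬ EnviesSet v X k (insert g (T k))) (ht : EnviesSet v X k (insert g (T t))) :
    EnviesSet v X k (T t ∪ (X k \ T k)) := by
  have hle : v k {g} ≤ v k (X k \ T k) := by
    by_contra hlt
    have := (O.canc k).union_lt (O.nd k) (O.disjoint_sdiff_fst k k) (O.disjoint_singleton_fst k)
      (not_le.1 hlt)
    rw [Finset.sdiff_union_of_subset (O.subset_fst k)] at this
    exact hk this
  have := (O.canc k).union_le (O.disjoint_singleton_fst t) (O.disjoint_sdiff_fst k t) hle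
  rw [Finset.union_comm]
  exact lt_of_lt_of_le ht this

/-- An agent who envies `T s` with the item prefers the item to what is discarded. -/
theorem not_envies_union_sdiff (O : OneEnvied v a X g h T T') {k s t : Fin 4} (hs : s ≠ 3)
    (hk : EnviesSet v X k (insert g (T s))) (ht : ¬ EnviesSet v X k (insert g (T t))) :
    ¬ EnviesSet v X k (T t ∪ (X s \ T s)) := by
  intro hlt
  have hle : v k (X s \ T s) < v k {g} := by
    refine (O.canc k).lt_of_union_lt (R := T s) (O.disjoint_sdiff_fst s s)
      (O.disjoint_singleton_fst s) ?_
    rw [Finset.sdiff_union_of_subset (O.subset_fst s)]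
    exact lt_of_le_of_lt (not_lt.1 (O.source s hs k)) hk
  have := (O.canc k).union_le (O.disjoint_sdiff_fst s t) (O.disjoint_singleton_fst t) hle.le
  rw [Finset.union_comm] at hlt
  exact ht (lt_of_lt_of_le hlt this)

/-- An agent preferring a discarded set to the item for one kept set does so for all of them. -/
theorem envies_union_sdiff_of (O : OneEnvied v a X g h T T') {k s t u : Fin 4}
    (hk : ¬ EnviesSet v X k (insert g (T t))) (ht : EnviesSet v X k (T t ∪ (X s \ T s)))
    (hu : EnviesSet v X k (insert g (T u))) : EnviesSet v X k (T u ∪ (X s \ T s)) := by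
  by_contra hn
  refine hk (lt_of_lt_of_le ht ?_)
  have hlt : v k (X s \ T s) < v k {g} := by
    refine (O.canc k).lt_of_union_lt (R := T u) (O.disjoint_sdiff_fst s u)
      (O.disjoint_singleton_fst u) ?_
    rw [Finset.union_comm _ (T u)]
    exact lt_of_le_of_lt (not_lt.1 hn) hu
  rw [Finset.union_comm]
  exact (O.canc k).union_le (O.disjoint_sdiff_fst s t) (O.disjoint_singleton_fst t) hlt.le

/-- Every envied set has a safe subset envied by one of the agents who envy the set. -/
theorem exists_champion {S : Finset ι} {k : Fin 4} (hk : EnviesSet v X k S) :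
    ∃ Z ⊆ S, Safe v (fun i => v i (X i)) Z ∧
      (EnviesSet v X 0 Z ∨ EnviesSet v X 1 Z ∨ EnviesSet v X 2 Z ∨ EnviesSet v X 3 Z) := by
  obtain ⟨Z, hZ, hs, c, hc⟩ := exists_safe_envied (fun i => v i (X i)) S k hk
  have hc' : EnviesSet v X c Z := hc
  refine ⟨Z, hZ, hs, ?_⟩
  fin_cases c
  exacts [Or.inl hc', Or.inr (Or.inl hc'), Or.inr (Or.inr (Or.inl hc')),
    Or.inr (Or.inr (Or.inr hc'))]

theorem envies_mono (O : OneEnvied v a X g h T T') {k : Fin 4} {Z S : Finset ι} (h : Z ⊆ S)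
    (hk : EnviesSet v X k Z) : EnviesSet v X k S := lt_of_lt_of_le hk (O.mono k h)

/-- Levels may be changed for an agent to whom a set is not worth more than her new level. -/
theorem safe_update (O : OneEnvied v a X g h T T') {Z : Finset ι}
    {r : Fin 4} {w : ℝ} (hs : Safe v (fun i => v i (X i)) Z) (hw : v r Z ≤ w) :
    Safe v (Function.update (fun i => v i (X i)) r w) Z := by
  intro j e he
  by_cases hj : j = r
  · subst hj
    simpa using (O.mono j (Finset.erase_subset e Z)).trans hw
  · simpa [hj] using hs j e he

end OneEnvied

namespace Cyclic

variable {ι : Type*} [DecidableEq ι] {v : Fin 4 → Finset ι → ℝ} {a : Fin 4 → Fin 4}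
  {X : Fin 4 → Finset ι} {g h : ι} {T T' : Fin 4 → Finset ι}

theorem symm (O : Cyclic v a X g h T T') : Cyclic v a X h g T' T :=
  ⟨O.toOneEnvied.symm, O.envies_zero', O.envies_zero, O.envies_two', O.envies_two,
    O.envies_one', O.envies_one⟩

theorem not_envies_one (O : Cyclic v a X g h T T') : ¬ EnviesSet v X 0 (insert g (T 1)) := by
  intro h01
  obtain ⟨hX, hgh, hg, hh, hT, hT'⟩ := O.apart
  have f20 := O.fits_fst ((O.envies_zero 2).2 rfl)
  have f12 := O.fits_fst ((O.envies_two 1).2 rfl)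
  have f20' := O.fits_snd ((O.envies_zero' 2).2 rfl)
  have e12' := (O.envies_two' 1).2 rfl
  have f12' := O.fits_snd e12'
  have f01 := O.fits_fst h01
  have n00 : ¬ EnviesSet v X 0 (insert g (T 0)) := by simp [O.envies_zero]
  have n10 : ¬ EnviesSet v X 1 (insert g (T 0)) := by simp [O.envies_zero]
  have n02 : ¬ EnviesSet v X 0 (insert g (T 2)) := by simp [O.envies_two]
  have n22 : ¬ EnviesSet v X 2 (insert g (T 2)) := by simp [O.envies_two]
  have n11 : ¬ EnviesSet v X 1 (insert g (T 1)) := fun hk => by simpa using O.envies_one _ hk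
  have n21 : ¬ EnviesSet v X 2 (insert g (T 1)) := fun hk => by simpa using O.envies_one _ hk
  have p0 : ∃ Z ⊆ T 1 ∪ (X 0 \ T 0), Fits v (fun i => v i (X i)) 1 Z := by
    obtain ⟨Z, hZ, hs, hc | hc | hc | hc⟩ :=
      OneEnvied.exists_champion (O.envies_union_sdiff n00 h01)
    · exact (O.not_pareto 1 e12' ⟨hs, hc.le⟩ f12' f20 (O.fits_own 3) (by intro e; grind)).elim
    · exact ⟨Z, hZ, hs, hc.le⟩
    · exact (O.not_envies_union_sdiff (by decide) ((O.envies_zero 2).2 rfl) n21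
        (O.envies_mono hZ hc)).elim
    · exact (O.not_pareto 1 e12' (O.fits_envied O.envied) f12' f20 ⟨hs, hc.le⟩
        (by intro e; grind)).elim
  obtain ⟨Z₁, hZ₁, f1⟩ := p0
  have p1 : ∃ Z ⊆ T 2 ∪ (X 1 \ T 1), Fits v (fun i => v i (X i)) 2 Z := by
    obtain ⟨Z, hZ, hs, hc | hc | hc | hc⟩ :=
      OneEnvied.exists_champion (O.envies_union_sdiff n11 ((O.envies_two 1).2 rfl))
    · exact (O.not_envies_union_sdiff (by decide) h01 n02 (O.envies_mono hZ hc)).elim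
    · exact (O.not_pareto 1 hc f01 ⟨hs, hc.le⟩ f20' (O.fits_own 3) (by intro e; grind)).elim
    · exact ⟨Z, hZ, hs, hc.le⟩
    · exact (O.not_pareto 3 hc (O.fits_envied O.envied) f1 f20 ⟨hs, hc.le⟩
        (by intro e; grind)).elim
  obtain ⟨Z₂, hZ₂, f2⟩ := p1
  obtain ⟨Z, hZ, hs, hc | hc | hc | hc⟩ :=
    OneEnvied.exists_champion (O.envies_union_sdiff n22 ((O.envies_zero 2).2 rfl))
  · exact O.not_pareto 0 hc ⟨hs, hc.le⟩ f1 f2 (O.fits_own 3) (by intro e; grind)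
  · exact O.not_envies_union_sdiff (by decide) ((O.envies_two 1).2 rfl) n10 (O.envies_mono hZ hc)
  · obtain ⟨k, hk⟩ := O.exists_snd 1 (by decide)
    rcases O.envies_one' k hk with rfl | rfl
    · exact O.not_pareto 2 hc (O.fits_snd hk) f12 ⟨hs, hc.le⟩ (O.fits_own 3) (by intro e; grind)
    · exact O.not_pareto 2 hc (O.fits_envied O.envied) f12 ⟨hs, hc.le⟩ (O.fits_snd hk)
        (by intro e; grind)
  · exact O.not_pareto 3 hc (O.fits_envied O.envied) f1 f2 ⟨hs, hc.le⟩ (by intro e; grind)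

end Cyclic

namespace Cyclic

variable {ι : Type*} [DecidableEq ι] {v : Fin 4 → Finset ι → ℝ} {a : Fin 4 → Fin 4}
  {X : Fin 4 → Finset ι} {g h : ι} {T T' : Fin 4 → Finset ι}

theorem envies_three_one (O : Cyclic v a X g h T T') : EnviesSet v X 3 (insert g (T 1)) := by
  obtain ⟨k, hk⟩ := O.exists_fst 1 (by decide)
  rcases O.envies_one k hk with rfl | rfl
  · exact (O.not_envies_one hk).elim
  · exact hk

theorem not_envies_three (O : Cyclic v a X g h T T') (k : Fin 4) (hk : k ≠ 0) :
    ¬ EnviesSet v X k (X 3) := by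
  intro hk3
  obtain ⟨hX, hgh, hg, hh, hT, hT'⟩ := O.apart
  have f31 := O.fits_fst O.envies_three_one
  have f12' := O.fits_snd ((O.envies_two' 1).2 rfl)
  have key : ∀ k : Fin 4, k ≠ 0 → k = 1 ∨ k = 2 ∨ k = 3 := by decide
  rcases key k hk with rfl | rfl | rfl
  · exact O.not_pareto 1 hk3 (O.fits_own 0) (O.fits_envied hk3) (O.fits_own 2) f31
      (by intro e; grind)
  · exact O.not_pareto 2 hk3 (O.fits_own 0) f12' (O.fits_envied hk3) f31 (by intro e; grind)
  · exact lt_irrefl _ hk3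

/-- Agent `0` can be made better off without hurting anyone but agent `2`. -/
theorem not_dominates_zero (O : Cyclic v a X g h T T')
    (hdom : ∀ Y : Fin 4 → Finset ι, v 3 (X 3) ≤ v 3 (Y 3) → v 0 (X 0) < v 0 (Y 0) →
      Dominates v a Y X) : False := by
  obtain ⟨hX, hgh, hg, hh, hT, hT'⟩ := O.apart
  have f31 := O.fits_fst O.envies_three_one
  have e31' := O.symm.envies_three_one
  have e12' := (O.envies_two' 1).2 rfl
  have f12' := O.fits_snd e12'
  have f20 := O.fits_fst ((O.envies_zero 2).2 rfl)
  have f03 := O.fits_envied O.envied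
  have n22' : ¬ EnviesSet v X 2 (insert h (T' 2)) := by simp [O.envies_two']
  have n10' : ¬ EnviesSet v X 1 (insert h (T' 0)) := by simp [O.envies_zero']
  have n30' : ¬ EnviesSet v X 3 (insert h (T' 0)) := by simp [O.envies_zero']
  have n11' : ¬ EnviesSet v X 1 (insert h (T' 1)) := fun hk => by simpa using O.envies_one' _ hk
  obtain ⟨W, hW, hWs, hW0⟩ : ∃ Z ⊆ T' 0 ∪ (X 2 \ T' 2), Safe v (fun i => v i (X i)) Z ∧
      EnviesSet v X 0 Z := by
    obtain ⟨Z, hZ, hs, hc | hc | hc | hc⟩ := OneEnvied.exists_champion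
      (O.symm.envies_union_sdiff n22' ((O.envies_zero' 2).2 rfl))
    · exact ⟨Z, hZ, hs, hc⟩
    · exact (O.symm.not_envies_union_sdiff (by decide) e12' n10' (O.envies_mono hZ hc)).elim
    · exact (O.not_pareto 2 hc f03 f12' ⟨hs, hc.le⟩ f31 (by intro e; grind)).elim
    · exfalso
      obtain ⟨Z, hZ, hs, hc | hc | hc | hc⟩ := OneEnvied.exists_champion
        (O.symm.envies_union_sdiff_of n30' (O.envies_mono hZ hc) e31')
      · exact O.not_pareto 0 hc ⟨hs, hc.le⟩ f12' f20 (O.fits_own 3) (by intro e; grind)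
      · exact O.symm.not_envies_union_sdiff (by decide) e12' n11' (O.envies_mono hZ hc)
      · exact O.not_pareto 2 hc (O.fits_own 0) f12' ⟨hs, hc.le⟩ (O.fits_own 3)
          (by intro e; grind)
      · exact O.not_pareto 3 hc f03 f12' f20 ⟨hs, hc.le⟩ (by intro e; grind)
  have key : ∀ A B C D : Finset ι, Safe v (fun i => v i (X i)) A → EnviesSet v X 0 A →
      Fits v (fun i => v i (X i)) 1 B → Safe v (fun i => v i (X i)) C →
      Fits v (fun i => v i (X i)) 3 D → v 2 A ≤ v 2 C → v 2 B ≤ v 2 C → v 2 D ≤ v 2 C →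
      PairwiseApart A B C D → False := by
    intro A B C D hA hA0 hB hC hD h1 h2 h3 hd
    refine O.not_improvable (Setting.improvable_of_fits
      (θ := Function.update (fun i => v i (X i)) 2 (v 2 C)) ⟨O.safe_update hA h1, ?_⟩
      ⟨O.safe_update hB.1 h2, ?_⟩ ⟨O.safe_update hC le_rfl, ?_⟩ ⟨O.safe_update hD.1 h3, ?_⟩ hd
      (hdom _ hD.2 hA0))
    · simpa using hA0.le
    · simpa using hB.2
    · simp
    · simpa using hD.2
  obtain ⟨C, hC, hmax⟩ := Finset.exists_max_image
    {W, X 0, X 1, X 3, insert g (T 1), insert h (T' 2)} (v 2) ⟨W, by simp⟩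
  simp only [Finset.mem_insert, Finset.mem_singleton, forall_eq_or_imp, forall_eq] at hC hmax
  obtain ⟨mW, m0, m1, m3, m31, m12⟩ := hmax
  have s3 := O.safe_own 3
  rcases hC with hC | hC | hC | hC | hC | hC
  · exact key (X 3) _ C _ s3 O.envied f12' (hC ▸ hWs) f31 m3 m12 m31 (by intro e; grind)
  · exact key (X 3) _ C _ s3 O.envied f12' (hC ▸ O.safe_own 0) f31 m3 m12 m31 (by intro e; grind)
  · exact key W _ C _ hWs hW0 f12' (hC ▸ O.safe_own 1) (O.fits_own 3) mW m12 m3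
      (by intro e; grind)
  · exact key W _ C _ hWs hW0 f12' (hC ▸ s3) f31 mW m12 m31 (by intro e; grind)
  · exact key W _ C _ hWs hW0 f12' (hC ▸ f31.1) (O.fits_own 3) mW m12 m3 (by intro e; grind)
  · exact key W _ C _ hWs hW0 (O.fits_own 1) (hC ▸ f12'.1) (O.fits_own 3) mW m1 m3
      (by intro e; grind)

/-- Agent `1` can be made better off without hurting anyone but agent `2`. -/
theorem not_dominates_one (O : Cyclic v a X g h T T')
    (hdom : ∀ Y : Fin 4 → Finset ι, v 3 (X 3) ≤ v 3 (Y 3) → v 1 (X 1) < v 1 (Y 1) →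
      Dominates v a Y X) : False := by
  obtain ⟨hX, hgh, hg, hh, hT, hT'⟩ := O.apart
  have f31 := O.fits_fst O.envies_three_one
  have e12' := (O.envies_two' 1).2 rfl
  have f12' := O.fits_snd e12'
  have e20 := (O.envies_zero 2).2 rfl
  have f20 := O.fits_fst e20
  have f03 := O.fits_envied O.envied
  have n22' : ¬ EnviesSet v X 2 (insert h (T' 2)) := by simp [O.envies_two']
  have key : ∀ A B C D : Finset ι, v 1 (X 1) < v 1 B →
      Fits v (Function.update (fun i => v i (X i)) 2 (v 2 C)) 0 A →
      Safe v (Function.update (fun i => v i (X i)) 2 (v 2 C)) B →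
      Safe v (Function.update (fun i => v i (X i)) 2 (v 2 C)) C →
      Fits v (Function.update (fun i => v i (X i)) 2 (v 2 C)) 3 D →
      PairwiseApart A B C D → False := by
    intro A B C D hlt hA hB hC hD hd
    refine O.not_improvable (Setting.improvable_of_fits hA
      ⟨hB, by simpa using hlt.le⟩ ⟨hC, by simp⟩ hD hd (hdom _ ?_ hlt))
    simpa using hD.2
  have lift : ∀ {A : Finset ι} {w : ℝ} (i : Fin 4), Fits v (fun i => v i (X i)) i A → i ≠ 2 →
      v 2 A ≤ w → Fits v (Function.update (fun i => v i (X i)) 2 w) i A := by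
    intro A w i hA hi hw
    exact ⟨O.safe_update hA.1 hw, by simpa [hi] using hA.2⟩
  obtain ⟨C, hC, hmax⟩ := Finset.exists_max_image
    {X 0, X 1, X 3, insert g (T 1), insert h (T' 2)} (v 2) ⟨X 0, by simp⟩
  simp only [Finset.mem_insert, Finset.mem_singleton, forall_eq_or_imp, forall_eq] at hC hmax
  obtain ⟨m0, m1, m3, m31, m12⟩ := hmax
  have u00 := lift 0 (O.fits_own 0) (by decide) m0
  have u03 := lift 0 f03 (by decide) m3
  have u12' := lift 1 f12' (by decide) m12
  have u31 := lift 3 f31 (by decide) m31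
  have u33 := lift 3 (O.fits_own 3) (by decide) m3
  have own : ∀ i, C = X i → Safe v (Function.update (fun i => v i (X i)) 2 (v 2 C)) C :=
    fun i hi => O.safe_update (hi ▸ O.safe_own i) le_rfl
  rcases hC with hC | hC | hC | hC | hC
  · exact key _ _ C _ e12' u03 u12'.1 (own 0 hC) u31 (by intro e; grind)
  · exact key _ _ C _ e12' u00 u12'.1 (own 1 hC) u33 (by intro e; grind)
  · exact key _ _ C _ e12' u00 u12'.1 (own 3 hC) u31 (by intro e; grind)
  · exact key _ _ C _ e12' u00 u12'.1 (O.safe_update (hC ▸ f31.1) le_rfl) u33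
      (by intro e; grind)
  · subst hC
    have hw : v 2 (insert h (T' 2)) ≤ v 2 (X 2) := not_lt.1 n22'
    obtain ⟨Z, hZ, hZs, hZ2⟩ : ∃ Z ⊆ insert g (T 0),
        Safe v (Function.update (fun i => v i (X i)) 2 (v 2 (insert h (T' 2)))) Z ∧
          v 2 (insert h (T' 2)) < v 2 Z := by
      obtain ⟨Z, hZ, hs, c, hc⟩ := exists_safe_envied
        (Function.update (fun i => v i (X i)) 2 (v 2 (insert h (T' 2)))) (insert g (T 0)) 2
        (by simpa using lt_of_le_of_lt hw e20)
      refine ⟨Z, hZ, hs, ?_⟩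
      by_cases hc2 : c = 2
      · simpa [hc2] using hc
      · refine absurd ((O.envies_zero c).1 (O.envies_mono hZ ?_)) hc2
        simpa [EnviesSet, hc2] using hc
    obtain ⟨e, he, heT⟩ : ∃ e ∈ X 2, e ∉ T' 2 := by
      by_contra! hall
      refine n22' ((O.nd 2).lt_of_ssubset (O.val 2) ?_)
      rw [O.subset_snd 2 |>.antisymm hall]
      exact Finset.ssubset_insert (hh 2)
    obtain ⟨W, hW, hWs, c, hc⟩ := exists_safe_envied
      (Function.update (fun i => v i (X i)) 2 (v 2 (insert h (T' 2)))) (X 1 ∪ (X 2 \ T' 2)) 1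
      (by
        simp only [ne_eq, Fin.reduceEq, not_false_eq_true, Function.update_of_ne]
        refine (O.nd 1).lt_of_ssubset (O.val 1) ⟨Finset.subset_union_left, fun hsub => ?_⟩
        have := hX e 1 2 (hsub (by grind)) he
        simp at this)
    have hself := O.safe_update (r := 2) f12'.1 le_rfl
    fin_cases c
    · exact O.not_improvable (Setting.improvable_of_fits ⟨hWs, hc.le⟩ u12'
        ⟨hZs, by simpa using hZ2.le⟩ u33 (by intro e; grind) (hdom _ le_rfl e12'))
    · exact key _ W (insert h (T' 2)) _ (by simpa using hc) u00 hWs hself u33 (by intro e; grind)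
    · exact O.not_improvable (Setting.improvable_of_fits u00 u12' ⟨hWs, hc.le⟩ u33
        (by intro e; grind) (hdom _ le_rfl e12'))
    · exact O.not_improvable (Setting.improvable_of_fits u03 u12' ⟨hZs, by simpa using hZ2.le⟩
        ⟨hWs, hc.le⟩ (by intro e; grind) (hdom _ (by simpa using hc.le) e12'))

/-- If agent `3` comes first and agent `2` second, the allocation can be improved. -/
theorem not_dominates_three_two (O : Cyclic v a X g h T T')
    (hdom : ∀ Y : Fin 4 → Finset ι, v 3 (X 3) ≤ v 3 (Y 3) → v 2 (X 2) ≤ v 2 (Y 2) →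
      (v 3 (X 3) < v 3 (Y 3) ∨ v 2 (X 2) < v 2 (Y 2)) → Dominates v a Y X) : False := by
  obtain ⟨hX, hgh, hg, hh, hT, hT'⟩ := O.apart
  have e31 := O.envies_three_one
  have f31 := O.fits_fst e31
  have e20' := (O.envies_zero' 2).2 rfl
  have f20' := O.fits_snd e20'
  have f03 := O.fits_envied O.envied
  have n11 : ¬ EnviesSet v X 1 (insert g (T 1)) := fun hk => by simpa using O.envies_one _ hk
  have n32 : ¬ EnviesSet v X 3 (insert g (T 2)) := by simp [O.envies_two]
  have key : ∀ A B C D : Finset ι, Fits v (fun i => v i (X i)) 0 A →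
      Safe v (fun i => v i (X i)) B → Fits v (fun i => v i (X i)) 2 C →
      Fits v (fun i => v i (X i)) 3 D → (v 3 (X 3) < v 3 D ∨ v 2 (X 2) < v 2 C) →
      v 1 A ≤ v 1 B → v 1 C ≤ v 1 B → v 1 D ≤ v 1 B → PairwiseApart A B C D → False := by
    intro A B C D hA hB hC hD hlt h1 h2 h3 hd
    refine O.not_improvable (Setting.improvable_of_fits
      (θ := Function.update (fun i => v i (X i)) 1 (v 1 B)) ⟨O.safe_update hA.1 h1, ?_⟩
      ⟨O.safe_update hB le_rfl, ?_⟩ ⟨O.safe_update hC.1 h2, ?_⟩ ⟨O.safe_update hD.1 h3, ?_⟩ hd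
      (hdom _ hD.2 hC.2 hlt))
    · simpa using hA.2
    · simp
    · simpa using hC.2
    · simpa using hD.2
  obtain ⟨W, hW, hWs, hW02⟩ : ∃ Z ⊆ T 2 ∪ (X 1 \ T 1), Safe v (fun i => v i (X i)) Z ∧
      (EnviesSet v X 0 Z ∨ EnviesSet v X 2 Z) := by
    obtain ⟨Z, hZ, hs, hc | hc | hc | hc⟩ := OneEnvied.exists_champion
      (O.envies_union_sdiff n11 ((O.envies_two 1).2 rfl))
    · exact ⟨Z, hZ, hs, Or.inl hc⟩
    · exact (O.not_pareto 1 hc f03 ⟨hs, hc.le⟩ f20' f31 (by intro e; grind)).elim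
    · exact ⟨Z, hZ, hs, Or.inr hc⟩
    · exact (O.not_envies_union_sdiff (by decide) e31 n32 (O.envies_mono hZ hc)).elim
  obtain ⟨C, hC, hmax⟩ := Finset.exists_max_image
    {W, X 0, X 2, X 3, insert g (T 1), insert h (T' 0)} (v 1) ⟨W, by simp⟩
  simp only [Finset.mem_insert, Finset.mem_singleton, forall_eq_or_imp, forall_eq] at hC hmax
  obtain ⟨mW, m0, m2, m3, m31, m20⟩ := hmax
  have own : ∀ i, C = X i → Safe v (fun i => v i (X i)) C := fun i hi => hi ▸ O.safe_own i
  rcases hC with hC | hC | hC | hC | hC | hC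
  · exact key _ C _ _ f03 (hC ▸ hWs) f20' f31 (Or.inl e31) m3 m20 m31 (by intro e; grind)
  · exact key _ C _ _ f03 (own 0 hC) (O.fits_own 2) f31 (Or.inl e31) m3 m2 m31
      (by intro e; grind)
  · exact key _ C _ _ f03 (own 2 hC) f20' f31 (Or.inl e31) m3 m20 m31 (by intro e; grind)
  · exact key _ C _ _ (O.fits_own 0) (own 3 hC) (O.fits_own 2) f31 (Or.inl e31) m0 m2 m31
      (by intro e; grind)
  · rcases hW02 with hc | hc
    · exact key W C _ _ ⟨hWs, hc.le⟩ (hC ▸ f31.1) f20' (O.fits_own 3) (Or.inr e20') mW m20 m3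
        (by intro e; grind)
    · exact key _ C W _ (O.fits_own 0) (hC ▸ f31.1) ⟨hWs, hc.le⟩ (O.fits_own 3) (Or.inr hc)
        m0 mW m3 (by intro e; grind)
  · exact key _ C _ _ f03 (hC ▸ f20'.1) (O.fits_own 2) f31 (Or.inl e31) m3 m2 m31
      (by intro e; grind)

end Cyclic

theorem Setting.improvable_of_fits_two {ι : Type*} [DecidableEq ι] {v : Fin 4 → Finset ι → ℝ}
    {a : Fin 4 → Fin 4} {X : Fin 4 → Finset ι} {θ : Fin 4 → ℝ} {A B C D : Finset ι}
    {c o : Fin 4} (hco : c = 0 ∧ o = 3 ∨ c = 3 ∧ o = 0)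
    (hdom : ∀ Y : Fin 4 → Finset ι, v 2 (X 2) < v 2 (Y 2) → Dominates v a Y X)
    (hlt : v 2 (X 2) < v 2 D) (hc : Fits v θ c A) (ho : Fits v θ o B) (h1 : Fits v θ 1 C)
    (h2 : Fits v θ 2 D) (hd : PairwiseApart A B C D) : Improvable v a X := by
  rcases hco with ⟨rfl, rfl⟩ | ⟨rfl, rfl⟩
  · exact Setting.improvable_of_fits hc h1 h2 ho
      (by intro e; have := hd e; tauto) (hdom _ hlt)
  · exact Setting.improvable_of_fits ho h1 h2 hc
      (by intro e; have := hd e; tauto) (hdom _ hlt)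

namespace Cyclic

variable {ι : Type*} [DecidableEq ι] {v : Fin 4 → Finset ι → ℝ} {a : Fin 4 → Fin 4}
  {X : Fin 4 → Finset ι} {g h : ι} {T T' : Fin 4 → Finset ι}

/-- If agent `2` comes first, no agent `c` is a champion of the envied bundle at levels that
allow the agents `0` and `3` to take one of three given sets. -/
theorem not_champion (O : Cyclic v a X g h T T')
    (hdom : ∀ Y : Fin 4 → Finset ι, v 2 (X 2) < v 2 (Y 2) → Dominates v a Y X)
    {θ : Fin 4 → ℝ} (hθ : ∀ i, θ i ≤ v i (X i)) (hθ1 : θ 1 = v 1 (X 1)) (hθ2 : θ 2 = v 2 (X 2))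
    (hmax : ∀ i, i = 0 ∨ i = 3 →
      v i (X 1) ≤ θ i ∧ v i (insert g (T 2)) ≤ θ i ∧ v i (insert h (T' 0)) ≤ θ i)
    (hmem : ∀ i, i = 0 ∨ i = 3 →
      θ i = v i (X 1) ∨ θ i = v i (insert g (T 2)) ∨ θ i = v i (insert h (T' 0)))
    {c o : Fin 4} (hco : c = 0 ∧ o = 3 ∨ c = 3 ∧ o = 0) {V₀ : Finset ι} (hV₀ : V₀ ⊆ X 3)
    (hVs₀ : Safe v θ V₀) (hVc₀ : θ c < v c V₀) : False := by
  obtain ⟨hX, hgh, hg, hh, hT, hT'⟩ := O.apart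
  have hc03 : c = 0 ∨ c = 3 := by tauto
  have ho03 : o = 0 ∨ o = 3 := by tauto
  have hc1 : (1 : Fin 4) ≠ c := by rintro rfl; simp at hc03
  have hc2 : (2 : Fin 4) ≠ c := by rintro rfl; simp at hc03
  have hoc : o ≠ c := by rintro rfl; rcases hco with ⟨rfl, h⟩ | ⟨rfl, h⟩ <;> simp at h
  have hcases : ∀ k, k = 1 ∨ k = 2 ∨ k = o ∨ k = c := by
    rcases hco with ⟨rfl, rfl⟩ | ⟨rfl, rfl⟩ <;> decide
  have e20' := (O.envies_zero' 2).2 rfl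
  have e12 := (O.envies_two 1).2 rfl
  have sP := O.safe_fst 2 (by decide)
  have sA := O.safe_snd 0 (by decide)
  -- a best set for `c` in the envied bundle
  obtain ⟨V, hV, hVmax⟩ := Finset.exists_max_image
    {V ∈ (X 3).powerset | θ c < v c V ∧ ∀ j, j ≠ c → ∀ e ∈ V, v j (V.erase e) ≤ θ j} (v c)
    ⟨V₀, by
      simp only [Finset.mem_filter, Finset.mem_powerset]
      exact ⟨hV₀, hVc₀, fun j _ => hVs₀ j⟩⟩
  simp only [Finset.mem_filter, Finset.mem_powerset, and_imp] at hV hVmax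
  obtain ⟨hV3, hVc, hVs⟩ := hV
  have up : ∀ {w : ℝ} {S : Finset ι}, θ c < w → Safe v (fun i => v i (X i)) S →
      (∀ i, i = 0 ∨ i = 3 → v i S ≤ θ i) → Safe v (Function.update θ c w) S := by
    intro w S hw hS hle j e he
    have hm := O.mono j (Finset.erase_subset e S)
    rcases hcases j with rfl | rfl | rfl | rfl
    · simpa [hc1, hθ1] using hS 1 e he
    · simpa [hc2, hθ2] using hS 2 e he
    · simpa [hoc] using hm.trans (hle _ ho03)
    · simpa using (hm.trans (hle _ hc03)).trans hw.le
  have sV : Safe v (Function.update θ c (v c V)) V := by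
    intro j e he
    by_cases hj : j = c
    · subst hj
      simpa using O.mono j (Finset.erase_subset e V)
    · simpa [hj] using hVs j hj e he
  have fV : Fits v (Function.update θ c (v c V)) c V := ⟨sV, by simp⟩
  have u1 := fun {w : ℝ} (hw : θ c < w) => up hw (O.safe_own 1) fun i hi => (hmax i hi).1
  have uP := fun {w : ℝ} (hw : θ c < w) => up hw sP fun i hi => (hmax i hi).2.1
  have uA := fun {w : ℝ} (hw : θ c < w) => up hw sA fun i hi => (hmax i hi).2.2
  have f1 : ∀ {w : ℝ}, θ c < w → Fits v (Function.update θ c w) 1 (X 1) :=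
    fun hw => ⟨u1 hw, by simp [hc1, hθ1]⟩
  have f2 : ∀ {w : ℝ}, θ c < w → Fits v (Function.update θ c w) 2 (insert h (T' 0)) :=
    fun hw => ⟨uA hw, by simpa [hc2, hθ2] using e20'.le⟩
  rcases hmem o ho03 with ho | ho | ho
  · exact O.not_improvable (Setting.improvable_of_fits_two hco hdom e20' fV
      ⟨u1 hVc, by simp [hoc, ho]⟩ ⟨uP hVc, by simpa [hc1, hθ1] using e12.le⟩ (f2 hVc)
      (by intro e; grind))
  · exact O.not_improvable (Setting.improvable_of_fits_two hco hdom e20' fV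
      ⟨uP hVc, by simp [hoc, ho]⟩ (f1 hVc) (f2 hVc) (by intro e; grind))
  obtain ⟨e, he, heT⟩ : ∃ e ∈ X 0, e ∉ T' 0 := by
    by_contra! hall
    refine absurd ((O.envies_zero' 0).1 ((O.nd 0).lt_of_ssubset (O.val 0) ?_)) (by decide)
    rw [O.subset_snd 0 |>.antisymm hall]
    exact Finset.ssubset_insert (hh 0)
  obtain ⟨Z, hZ, hZs, k, hk⟩ := exists_safe_envied (Function.update θ c (v c V))
    (X 2 ∪ (X 0 \ T' 0)) 2 (by
      simp only [ne_eq, hc2, not_false_eq_true, Function.update_of_ne, hθ2]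
      refine (O.nd 2).lt_of_ssubset (O.val 2) ⟨Finset.subset_union_left, fun hsub => ?_⟩
      have := hX e 2 0 (hsub (by grind)) he
      simp at this)
  have fo : ∀ {w : ℝ}, θ c < w → Fits v (Function.update θ c w) o (insert h (T' 0)) :=
    fun hw => ⟨uA hw, by simp [hoc, ho]⟩
  rcases hcases k with rfl | rfl | rfl | rfl
  · have hle : ∀ i, Function.update θ c (v c V) i ≤
        Function.update (fun i => v i (X i)) 0 (v 0 (X 3)) i := by
      intro i
      by_cases hi : i = c
      · subst hi
        have := O.mono i hV3
        rcases hc03 with rfl | rfl <;> simpa using this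
      · by_cases hi0 : i = 0
        · subst hi0
          simpa [hi] using (hθ 0).trans O.envied.le
        · simpa [hi, hi0] using hθ i
    have hle' : ∀ i, v i (X i) ≤ Function.update (fun i => v i (X i)) 0 (v 0 (X 3)) i := by
      intro i
      by_cases hi0 : i = 0
      · subst hi0
        simpa using O.envied.le
      · simp [hi0]
    have f31 := O.fits_fst O.envies_three_one
    exact O.not_improvable (Setting.improvable_of_fits ⟨(O.safe_own 3).mono hle', by simp⟩
      ⟨hZs.mono hle, by simpa [hc1, hθ1] using hk.le⟩ ⟨sA.mono hle', by simpa using e20'.le⟩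
      ⟨f31.1.mono hle', by simpa using f31.2⟩ (by intro e; grind) (hdom _ e20'))
  · exact O.not_improvable (Setting.improvable_of_fits_two hco hdom
      (by simpa [hc2, hθ2] using hk) fV (fo hVc) (f1 hVc) ⟨hZs, hk.le⟩ (by intro e; grind))
  · exact O.not_improvable (Setting.improvable_of_fits_two hco hdom e20' fV ⟨hZs, hk.le⟩
      (f1 hVc) (f2 hVc) (by intro e; grind))
  · have hZV : v k V < v k Z := by simpa using hk
    have hkZ := hVc.trans hZV
    have hoX : θ o < v o (X 3) := by
      rcases ho03 with rfl | rfl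
      · exact (hθ 0).trans_lt O.envied
      · refine lt_of_le_of_ne (hθ 3) ?_
        rw [ho]
        exact (O.nd 3) _ _ fun heq => hh 3 (heq ▸ Finset.mem_insert_self _ _)
    obtain ⟨W, hW, hWs, m, hm⟩ := exists_safe_envied (Function.update θ k (v k Z)) (X 3) o
      (by simpa [hoc] using hoX)
    have hle : ∀ i, Function.update θ k (v k V) i ≤ Function.update θ k (v k Z) i := by
      intro i
      by_cases hi : i = k
      · subst hi
        simpa using hZV.le
      · simp [hi]
    rcases hcases m with rfl | rfl | rfl | rfl
    · refine O.not_envies_three 1 (by decide) (O.envies_mono hW ?_)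
      simpa [hc1, hθ1, EnviesSet] using hm
    · refine O.not_envies_three 2 (by decide) (O.envies_mono hW ?_)
      simpa [hc2, hθ2, EnviesSet] using hm
    · exact O.not_improvable (Setting.improvable_of_fits_two hco hdom e20'
        ⟨hZs.mono hle, by simp⟩ ⟨hWs, hm.le⟩ (f1 hkZ) (f2 hkZ) (by intro e; grind))
    · have hWZ : v m Z < v m W := by simpa using hm
      refine absurd (hVmax W hW (hkZ.trans hWZ) fun j hj e he => ?_)
        (not_le.2 (hZV.trans hWZ))
      simpa [hj] using hWs j e he

/-- If agent `2` comes first, the allocation can be improved. -/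
theorem not_dominates_two (O : Cyclic v a X g h T T')
    (hdom : ∀ Y : Fin 4 → Finset ι, v 2 (X 2) < v 2 (Y 2) → Dominates v a Y X) : False := by
  have hP : ∀ k, k = 0 ∨ k = 3 → ¬ EnviesSet v X k (insert g (T 2)) := by
    rintro k (rfl | rfl) <;> simp [O.envies_two]
  have hA : ∀ k, k = 0 ∨ k = 3 → ¬ EnviesSet v X k (insert h (T' 0)) := by
    rintro k (rfl | rfl) <;> simp [O.envies_zero']
  obtain ⟨m, hm⟩ : ∃ m : Fin 4 → ℝ, m = fun i => max (v i (X 1))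
    (max (v i (insert g (T 2))) (v i (insert h (T' 0)))) := ⟨_, rfl⟩
  have hmle : ∀ i, i = 0 ∨ i = 3 → m i ≤ v i (X i) := by
    intro i hi
    rw [hm]
    exact max_le (not_lt.1 (O.source 1 (by decide) i))
      (max_le (not_lt.1 (hP i hi)) (not_lt.1 (hA i hi)))
  obtain ⟨θ, hθ1, hθ2, hθm⟩ : ∃ θ : Fin 4 → ℝ, θ 1 = v 1 (X 1) ∧ θ 2 = v 2 (X 2) ∧
      ∀ i, i = 0 ∨ i = 3 → θ i = m i :=
    ⟨![m 0, v 1 (X 1), v 2 (X 2), m 3], rfl, rfl, by rintro i (rfl | rfl) <;> rfl⟩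
  have hθ : ∀ i, θ i ≤ v i (X i) := by
    intro i
    by_cases hi : i = 0 ∨ i = 3
    · exact (hθm i hi).trans_le (hmle i hi)
    · have : i = 1 ∨ i = 2 := by decide +revert
      rcases this with rfl | rfl
      exacts [hθ1.le, hθ2.le]
  obtain ⟨V, hV, hVs, c, hc⟩ := exists_safe_envied θ (X 3) 0 ((hθ 0).trans_lt O.envied)
  have hlt : c ≠ 1 ∧ c ≠ 2 := by
    constructor <;> rintro rfl
    · exact O.not_envies_three 1 (by decide) (O.envies_mono hV (hθ1.symm.trans_lt hc))
    · exact O.not_envies_three 2 (by decide) (O.envies_mono hV (hθ2.symm.trans_lt hc))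
  obtain ⟨o, hco⟩ : ∃ o : Fin 4, c = 0 ∧ o = 3 ∨ c = 3 ∧ o = 0 := by
    clear hc
    decide +revert
  refine O.not_champion hdom hθ hθ1 hθ2 ?_ ?_ hco hV hVs hc
  · intro i hi
    rw [hθm i hi, hm]
    simp
  · intro i hi
    rw [hθm i hi, hm]
    dsimp only
    rcases max_choice (v i (X 1)) (max (v i (insert g (T 2))) (v i (insert h (T' 0))))
      with h1 | h1
    · exact Or.inl h1
    · rw [h1]
      rcases max_choice (v i (insert g (T 2))) (v i (insert h (T' 0))) with h2 | h2
      exacts [Or.inr (Or.inl h2), Or.inr (Or.inr h2)]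

theorem false (O : Cyclic v a X g h T T') : False := by
  have horder : ∀ a : Fin 4 → Fin 4, Function.Injective a →
      (∃ k, a k = 0 ∧ ∀ j < k, a j = 3) ∨ (∃ k, a k = 1 ∧ ∀ j < k, a j = 3) ∨ a 0 = 2 ∨
        (a 0 = 3 ∧ a 1 = 2) := by
    decide +kernel
  rcases horder a O.bij.1 with ⟨k, hk, hj⟩ | ⟨k, hk, hj⟩ | h2 | ⟨h3, h2⟩
  · exact O.not_dominates_zero fun Y h3 h0 => dominates_of_le k
      (fun j hjk => by rw [hj j hjk]; exact h3) (by rw [hk]; exact h0)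
  · exact O.not_dominates_one fun Y h3 h1 => dominates_of_le k
      (fun j hjk => by rw [hj j hjk]; exact h3) (by rw [hk]; exact h1)
  · exact O.not_dominates_two fun Y hY => dominates_of_le 0
      (fun j hj => absurd hj (Fin.not_lt_zero j)) (by rw [h2]; exact hY)
  · refine O.not_dominates_three_two fun Y hY3 hY2 hlt => ?_
    rcases hlt with hlt | hlt
    · exact dominates_of_le 0 (fun j hj => absurd hj (Fin.not_lt_zero j)) (by rw [h3]; exact hlt)
    · refine dominates_of_le 1 (fun j hj => ?_) (by rw [h2]; exact hlt)
      have : j = 0 := by decide +revert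
      rw [this, h3]
      exact hY3

end Cyclic

theorem OneEnvied.false {ι : Type*} [DecidableEq ι] {v : Fin 4 → Finset ι → ℝ}
    {a : Fin 4 → Fin 4} {X : Fin 4 → Finset ι} {g h : ι} {T T' : Fin 4 → Finset ι}
    (O : OneEnvied v a X g h T T') : False :=
  O.cyclic_or.elim Cyclic.false Cyclic.false

namespace Setting

variable {ι : Type*} [DecidableEq ι] {v : Fin 4 → Finset ι → ℝ} {a : Fin 4 → Fin 4}
  {X : Fin 4 → Finset ι}

/-- An allocation whose only envied agent `3` is envied by `0` is improvable. -/
theorem improvable_of_envied_three (S : Setting v a X) {g h : ι} (hgh : g ≠ h)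
    (hg : ∀ i, g ∉ X i) (hh : ∀ i, h ∉ X i) (henv : EnviesSet v X 0 (X 3))
    (hsrc : ∀ i, i ≠ 3 → ∀ k, ¬ EnviesSet v X k (X i)) : Improvable v a X := by
  have key : ∀ x, (∀ i, x ∉ X i) → ∀ i, ∃ T ⊆ X i, i ≠ 3 →
      Safe v (fun i => v i (X i)) (insert x T) ∧ ∃ c, EnviesSet v X c (insert x T) := by
    intro x hx i
    by_cases hi : i = 3
    · exact ⟨∅, Finset.empty_subset _, fun h => absurd hi h⟩
    · obtain ⟨T, hT, h⟩ := S.exists_champion_set (hsrc i hi) (hx i)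
      exact ⟨T, hT, fun _ => h⟩
  choose T hT hTc using key g hg
  choose T' hT' hTc' using key h hh
  by_contra hn
  exact OneEnvied.false
    { S with
      not_improvable := hn
      ne := hgh
      notMem_fst := hg
      notMem_snd := hh
      subset_fst := hT
      subset_snd := hT'
      safe_fst := fun i hi => (hTc i hi).1
      safe_snd := fun i hi => (hTc' i hi).1
      exists_fst := fun i hi => (hTc i hi).2
      exists_snd := fun i hi => (hTc' i hi).2
      source := hsrc
      envied := henv }

theorem improvable (S : Setting v a X) {g h : ι} (hgh : g ≠ h)
    (hg : ∀ i, g ∉ X i) (hh : ∀ i, h ∉ X i) : Improvable v a X := by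
  by_contra hn
  refine hn (S.improvable_of_envyFree (fun e r her => ?_) hgh hg hh)
  have hsrc : ∀ i, i ≠ r → ∀ k, ¬ EnviesSet v X k (X i) := by
    intro i hi k hk
    obtain ⟨s, t, hst⟩ : ∃ s t : Fin 4, ∀ j, j ≠ s → j ≠ t → j = i ∨ j = r := by
      clear her hk
      decide +revert
    refine hn (S.improvable_of_few_sources hgh hg hh (s := s) (t := t) fun j hs ht => ?_)
    rcases hst j hs ht with rfl | rfl
    exacts [⟨k, hk⟩, ⟨e, her⟩]
  have hne : e ≠ r := by
    rintro rfl
    exact lt_irrefl _ her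
  obtain ⟨π, h0, h3⟩ : ∃ π : Equiv.Perm (Fin 4), π 0 = e ∧ π 3 = r := by
    clear her hsrc
    decide +revert
  refine hn (Improvable.perm (π := π) ((S.perm π).improvable_of_envied_three hgh
    (fun i => hg _) (fun i => hh _) ?_ fun i hi k => ?_))
  · simpa [EnviesSet, h0, h3] using her
  · exact hsrc (π i) (fun h => hi (π.injective (h.trans h3.symm))) (π k)

end Setting

/-- Fix an arbitrary ordering of 4 agents whose valuations are
non-degenerate and cancelable.  If `X` is a partial EFX allocation with at least
two unallocated items, then some partial EFX allocation `Y` dominates `X`. -/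
theorem efx_four_agents_dominating_allocation
    {ι : Type*} [DecidableEq ι] [Fintype ι]
    (v : Fin 4 → Finset ι → ℝ) (hval : ∀ i, IsValuation (v i))
    (hnd : ∀ i, NonDegenerate (v i)) (hc : ∀ i, Cancelable (v i))
    (a : Fin 4 → Fin 4) (ha : Function.Bijective a)
    (X : Fin 4 → Finset ι) (hX : IsPartialAlloc X) (hEFX : IsEFX v X)
    (hU : 2 ≤ (unalloc X).card) :
    ∃ Y : Fin 4 → Finset ι, IsPartialAlloc Y ∧ IsEFX v Y ∧ Dominates v a Y X := by
  obtain ⟨g, hg, h, hh, hgh⟩ := Finset.one_lt_card.1 hU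
  have hout : ∀ x ∈ unalloc X, ∀ i, x ∉ X i := by
    intro x hx i hi
    exact (Finset.mem_sdiff.1 hx).2 (Finset.mem_biUnion.2 ⟨i, Finset.mem_univ i, hi⟩)
  exact Setting.improvable ⟨hval, hnd, hc, ha, hX, hEFX⟩ hgh (hout g hg) (hout h hh)

end FairDivision
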